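/- arXiv:1208.3582 — 2 statements merged into one kernel-verified Lean document; each statement's English description precedes it below -/
import Mathlib

section
/- If p ∈ ℝ⟨x⟩ is a symmetric free polynomial that is quasi-convex, then either −p is a hermitian sum of squares, or there exist a polynomial ℓ ∈ ℝ⟨x⟩ that is homogeneous of degree one and finitely many polynomials s₁,…,s_m ∈ ℝ⟨x⟩, each homogeneous of degree one, such that p = ℓ + Σⱼ sⱼ* sⱼ. In particular, in the second case p has degree at most two. -/
open scoped BigOperators

noncomputable section

/-- Evaluation of a free polynomial `p ∈ ℝ⟨x₁,…,x_g⟩` at a `g`-tuple of square matrices;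
the empty word evaluates to the identity matrix. -/
def evalMat {g : ℕ} {ι : Type} [Fintype ι] [DecidableEq ι]
    (p : FreeAlgebra ℝ (Fin g)) (X : Fin g → Matrix ι ι ℝ) : Matrix ι ι ℝ :=
  FreeAlgebra.lift ℝ X p

/-- `p` is a hermitian sum of squares: `p = Σⱼ hⱼ* hⱼ`. -/
def IsHermitianSOS {g : ℕ} (p : FreeAlgebra ℝ (Fin g)) : Prop :=
  ∃ (m : ℕ) (h : Fin m → FreeAlgebra ℝ (Fin g)), p = ∑ j, star (h j) * h j

/-- `p` is quasi-convex: `p(0) = 0` and for every positive integer `n` and every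
positive definite `A ∈ 𝕊ₙ(ℝ)`, the set `{X ∈ 𝕊ₙ(ℝ^g) : A − p(X) ≻ 0}` is convex. -/
def IsQuasiConvex {g : ℕ} (p : FreeAlgebra ℝ (Fin g)) : Prop :=
  (∀ n : ℕ, evalMat p (fun _ => (0 : Matrix (Fin n) (Fin n) ℝ)) = 0) ∧
  ∀ n : ℕ, 0 < n → ∀ A : Matrix (Fin n) (Fin n) ℝ, A.PosDef →
    Convex ℝ {X : Fin g → Matrix (Fin n) (Fin n) ℝ |
      (∀ j, (X j).IsSymm) ∧ (A - evalMat p X).PosDef}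

/-- The space of free polynomials homogeneous of degree one (linear span of the variables).  -/
def degOne (g : ℕ) : Submodule ℝ (FreeAlgebra ℝ (Fin g)) :=
  Submodule.span ℝ (Set.range (FreeAlgebra.ι ℝ : Fin g → FreeAlgebra ℝ (Fin g)))

/-- The space of free polynomials of degree at most `k`. -/
def degLE (g k : ℕ) : Submodule ℝ (FreeAlgebra ℝ (Fin g)) :=
  ⨆ i ∈ Finset.range (k + 1), (degOne g) ^ i

/-- `M` has a positive eigenvalue (with corresponding eigenvector). -/
def HasPosEigenvalue {n : ℕ} (M : Matrix (Fin n) (Fin n) ℝ) : Prop :=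
  ∃ (lam : ℝ) (v : Fin n → ℝ), 0 < lam ∧ v ≠ 0 ∧ M.mulVec v = lam • v

/-- The directional derivative `p′(X)[H]`: the coefficient of `t` in `t ↦ p(X + tH)`. -/
def derivEval {g n : ℕ} (p : FreeAlgebra ℝ (Fin g))
    (X H : Fin g → Matrix (Fin n) (Fin n) ℝ) : Matrix (Fin n) (Fin n) ℝ :=
  (FreeAlgebra.lift ℝ
      (fun j => Polynomial.C (X j) + Polynomial.X * Polynomial.C (H j)) p).coeff 1

/-- The Hessian `p″(X)[H]`: twice the coefficient of `t²` in `t ↦ p(X + tH)`. -/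
def hessEval {g n : ℕ} (p : FreeAlgebra ℝ (Fin g))
    (X H : Fin g → Matrix (Fin n) (Fin n) ℝ) : Matrix (Fin n) (Fin n) ℝ :=
  (2 : ℝ) • (FreeAlgebra.lift ℝ
      (fun j => Polynomial.C (X j) + Polynomial.X * Polynomial.C (H j)) p).coeff 2

/-- The constant term of a free polynomial (so that `p(0)` is `constantTerm p` times the
identity matrix). -/
def constantTerm {g : ℕ} (p : FreeAlgebra ℝ (Fin g)) : ℝ :=
  FreeAlgebra.lift ℝ (fun _ : Fin g => (0 : ℝ)) p

/-- Evaluation of a word `w = x_{j₁}⋯x_{j_k}` at a tuple of matrices: `X_{j₁}⋯X_{j_k}`. -/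
def wordEval {g n : ℕ} (X : Fin g → Matrix (Fin n) (Fin n) ℝ)
    (w : FreeMonoid (Fin g)) : Matrix (Fin n) (Fin n) ℝ :=
  (w.toList.map X).prod

open Matrix Finset
open scoped MatrixOrder

/-- Words in `g` letters of length at most `N`. -/
abbrev ShortWord (g N : ℕ) : Type := {w : List (Fin g) // w.length ≤ N}

instance ShortWord.instFintype (g N : ℕ) : Fintype (ShortWord g N) :=
  have : Finite (ShortWord g N) := (List.finite_length_le (Fin g) N).to_subtype
  Fintype.ofFinite _

/-- The monomial of `ℝ⟨x⟩` spelled by a word. -/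
def freeWord {g : ℕ} (w : List (Fin g)) : FreeAlgebra ℝ (Fin g) :=
  (w.map (FreeAlgebra.ι ℝ)).prod

@[simp]
lemma freeWord_nil {g : ℕ} : freeWord ([] : List (Fin g)) = 1 := rfl

lemma freeWord_cons {g : ℕ} (j : Fin g) (w : List (Fin g)) :
    freeWord (j :: w) = FreeAlgebra.ι ℝ j * freeWord w := by
  simp [freeWord]

lemma freeWord_append {g : ℕ} (u w : List (Fin g)) :
    freeWord (u ++ w) = freeWord u * freeWord w := by
  simp [freeWord]

lemma star_freeWord {g : ℕ} (w : List (Fin g)) : star (freeWord w) = freeWord w.reverse := by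
  induction w with
  | nil => simp
  | cons j w ih =>
    rw [freeWord_cons, star_mul, ih, FreeAlgebra.star_ι, List.reverse_cons, freeWord_append]
    simp [freeWord]

lemma star_real_smul {g : ℕ} (r : ℝ) (q : FreeAlgebra ℝ (Fin g)) :
    star (r • q) = r • star q := by
  rw [Algebra.smul_def, star_mul, FreeAlgebra.star_algebraMap, Algebra.smul_def,
    Algebra.commutes]

/-- The free polynomial with prescribed coefficients. -/
def ofCoeff (g : ℕ) : (List (Fin g) →₀ ℝ) →ₗ[ℝ] FreeAlgebra ℝ (Fin g) :=
  Finsupp.linearCombination ℝ freeWord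

lemma ofCoeff_single {g : ℕ} (w : List (Fin g)) (r : ℝ) :
    ofCoeff g (Finsupp.single w r) = r • freeWord w :=
  Finsupp.linearCombination_single ℝ r w

lemma ofCoeff_surjective (g : ℕ) : Function.Surjective (ofCoeff g) := by
  rw [← LinearMap.range_eq_top, ofCoeff, Finsupp.range_linearCombination, eq_top_iff]
  have hmul : ∀ a ∈ Submodule.span ℝ (Set.range (freeWord (g := g))),
      ∀ b ∈ Submodule.span ℝ (Set.range (freeWord (g := g))),
        a * b ∈ Submodule.span ℝ (Set.range (freeWord (g := g))) := by
    intro a ha b hb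
    have := Submodule.mul_mem_mul ha hb
    rw [Submodule.span_mul_span] at this
    refine Submodule.span_mono ?_ this
    rintro _ ⟨_, ⟨u, rfl⟩, _, ⟨w, rfl⟩, rfl⟩
    exact ⟨u ++ w, freeWord_append u w⟩
  rintro q -
  induction q using FreeAlgebra.induction with
  | grade0 r =>
    rw [Algebra.algebraMap_eq_smul_one]
    exact Submodule.smul_mem _ _ (Submodule.subset_span ⟨[], rfl⟩)
  | grade1 j => exact Submodule.subset_span ⟨[j], by simp [freeWord]⟩
  | mul a b ha hb => exact hmul a ha b hb
  | add a b ha hb => exact add_mem ha hb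

/-- The coefficients of the reversed polynomial. -/
def reverseCoeff (g : ℕ) : (List (Fin g) →₀ ℝ) ≃ₗ[ℝ] (List (Fin g) →₀ ℝ) :=
  Finsupp.domLCongr List.reverse_involutive.toPerm

lemma reverseCoeff_apply {g : ℕ} (a : List (Fin g) →₀ ℝ) (w : List (Fin g)) :
    reverseCoeff g a w = a w.reverse := by
  simp [reverseCoeff]

lemma star_ofCoeff {g : ℕ} (a : List (Fin g) →₀ ℝ) :
    star (ofCoeff g a) = ofCoeff g (reverseCoeff g a) := by
  induction a using Finsupp.induction_linear with
  | zero => simp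
  | add a b ha hb => simp [ha, hb]
  | single w r =>
    simp [reverseCoeff, ofCoeff_single, star_real_smul, star_freeWord]

lemma exists_symmetric_coeff {g : ℕ} (p : FreeAlgebra ℝ (Fin g)) (hp : star p = p) :
    ∃ a : List (Fin g) →₀ ℝ, (∀ w, a w.reverse = a w) ∧ ofCoeff g a = p := by
  obtain ⟨b, rfl⟩ := ofCoeff_surjective g p
  refine ⟨(1 / 2 : ℝ) • (b + reverseCoeff g b), fun w => ?_, ?_⟩
  · simp [reverseCoeff_apply, add_comm]
  · rw [map_smul, map_add, ← star_ofCoeff, hp, ← two_smul ℝ, smul_smul]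
    norm_num

lemma isHermitianSOS_sum {g : ℕ} {κ : Type*} [Fintype κ] (h : κ → FreeAlgebra ℝ (Fin g)) :
    IsHermitianSOS (∑ k, star (h k) * h k) :=
  ⟨Fintype.card κ, h ∘ (Fintype.equivFin κ).symm,
    ((Fintype.equivFin κ).symm.sum_comp (fun k => star (h k) * h k)).symm⟩

/-- The coefficients of `Σ G(u,v) u* v`. -/
def gramCoeff (g N : ℕ) :
    Matrix (ShortWord g N) (ShortWord g N) ℝ →ₗ[ℝ] (List (Fin g) →₀ ℝ) :=
  ∑ u, ∑ v, Finsupp.lsingle (u.1.reverse ++ v.1) ∘ₗ Matrix.entryLinearMap ℝ ℝ u v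

lemma gramCoeff_apply {g N : ℕ} (G : Matrix (ShortWord g N) (ShortWord g N) ℝ) :
    gramCoeff g N G = ∑ u, ∑ v, Finsupp.single (u.1.reverse ++ v.1) (G u v) := by
  simp [gramCoeff, LinearMap.sum_apply]

lemma isHermitianSOS_gramCoeff {g N : ℕ} {G : Matrix (ShortWord g N) (ShortWord g N) ℝ}
    (hG : G.PosSemidef) : IsHermitianSOS (ofCoeff g (gramCoeff g N G)) := by
  classical
  obtain ⟨B, rfl⟩ := CStarAlgebra.nonneg_iff_eq_star_mul_self.mp hG.nonneg
  convert isHermitianSOS_sum (fun k => ∑ v, B k v • freeWord v.1) using 1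
  simp only [gramCoeff_apply, map_sum, ofCoeff_single, star_sum, star_real_smul, star_freeWord,
    Finset.sum_mul_sum, smul_mul_smul_comm, ← freeWord_append, star_eq_conjTranspose,
    Matrix.mul_apply, conjTranspose_apply, star_trivial, Finset.sum_smul]
  rw [Finset.sum_comm_cycle]
  
lemma gramCoeff_ne_zero {g N : ℕ} {G : Matrix (ShortWord g N) (ShortWord g N) ℝ}
    (hG : G.PosSemidef) (h0 : gramCoeff g N G = 0) : G.trace = 0 := by
  classical
  obtain ⟨B, rfl⟩ := CStarAlgebra.nonneg_iff_eq_star_mul_self.mp hG.nonneg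
  have hdiag : ∀ u, (star B * B) u u = ∑ k, B k u ^ 2 := fun u => by
    simp [star_eq_conjTranspose, Matrix.mul_apply, sq]
  suffices h : ∀ u k, B k u = 0 by
    simp [Matrix.trace, hdiag, h]
  by_contra! hne
  obtain ⟨u₀, hu₀⟩ := hne
  obtain ⟨u, ⟨k, hk⟩, hmax⟩ := Set.Finite.exists_maximalFor
    (fun u : ShortWord g N => u.1.length) {u | ∃ k, B k u ≠ 0} (Set.toFinite _) ⟨u₀, hu₀⟩
  have hbig : ∀ v : ShortWord g N, u.1.length < v.1.length → ∀ k, B k v = 0 := by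
    intro v hv k
    by_contra hk
    exact absurd (hmax ⟨k, hk⟩ hv.le) (not_le.mpr hv)
  have hcoeff := DFunLike.congr_fun h0 (u.1.reverse ++ u.1)
  rw [gramCoeff_apply] at hcoeff
  simp only [Finsupp.coe_finsetSum, Finset.sum_apply, Finsupp.coe_zero, Pi.zero_apply] at hcoeff
  rw [Finset.sum_eq_single u, Finset.sum_eq_single u, Finsupp.single_eq_same, hdiag] at hcoeff
  · rw [Finset.sum_eq_zero_iff_of_nonneg (fun _ _ => sq_nonneg _)] at hcoeff
    exact hk (by simpa using hcoeff k (Finset.mem_univ k))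
  · intro v _ hv
    refine Finsupp.single_eq_of_ne' fun h => hv (Subtype.ext ?_)
    exact List.append_cancel_left h
  · simp
  · intro v _ hv
    refine Finset.sum_eq_zero fun w _ => ?_
    by_cases h : v.1.reverse ++ w.1 = u.1.reverse ++ u.1
    · have hlen := congrArg List.length h
      simp only [List.length_append, List.length_reverse] at hlen
      have hz : (star B * B) v w = 0 := by
        simp only [star_eq_conjTranspose, Matrix.mul_apply, conjTranspose_apply, star_trivial]
        refine Finset.sum_eq_zero fun k _ => ?_
        rcases lt_trichotomy v.1.length u.1.length with hlt | heq | hgt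
        · rw [hbig w (by omega), mul_zero]
        · refine absurd (Subtype.ext ?_) hv
          exact List.reverse_injective (List.append_inj_left h (by simpa using heq))
        · rw [hbig v hgt, zero_mul]
      rw [hz, Finsupp.single_zero, Finsupp.zero_apply]
    · exact Finsupp.single_eq_of_ne' h
  · simp

lemma isCompact_posSemidef_trace_one (ι : Type*) [Fintype ι] :
    IsCompact {G : Matrix ι ι ℝ | G.PosSemidef ∧ G.trace = 1} := by
  classical
  have himage : {G : Matrix ι ι ℝ | G.PosSemidef ∧ G.trace = 1} =
      (fun B : Matrix ι ι ℝ => Bᵀ * B) '' {B | ∑ i, ∑ k, B k i ^ 2 = 1} := by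
    have htrace : ∀ B : Matrix ι ι ℝ, (Bᵀ * B).trace = ∑ i, ∑ k, B k i ^ 2 := fun B => by
      simp [Matrix.trace, Matrix.mul_apply, sq]
    ext G
    constructor
    · rintro ⟨hG, htr⟩
      obtain ⟨B, rfl⟩ := CStarAlgebra.nonneg_iff_eq_star_mul_self.mp hG.nonneg
      rw [star_eq_conjTranspose, conjTranspose_eq_transpose_of_trivial] at htr ⊢
      exact ⟨B, by rwa [htrace] at htr, rfl⟩
    · rintro ⟨B, hB, rfl⟩
      refine ⟨?_, (htrace B).trans hB⟩
      simpa using posSemidef_conjTranspose_mul_self B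
  rw [himage]
  refine IsCompact.image ?_ (by fun_prop)
  have hbox : IsCompact (Set.univ.pi fun _ : ι => Set.univ.pi fun _ : ι => Set.Icc (-1 : ℝ) 1) :=
    isCompact_univ_pi fun _ => isCompact_univ_pi fun _ => isCompact_Icc
  refine hbox.of_isClosed_subset (isClosed_eq (by fun_prop) continuous_const) ?_
  intro B hB
  simp only [Set.mem_pi, Set.mem_univ, true_implies, Set.mem_Icc]
  intro k i
  have h1 : B k i ^ 2 ≤ 1 := by
    rw [← show ∑ i, ∑ k, B k i ^ 2 = 1 from hB]
    refine le_trans ?_ (Finset.single_le_sum (fun i _ => Finset.sum_nonneg fun k _ =>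
      sq_nonneg (B k i)) (Finset.mem_univ i))
    exact Finset.single_le_sum (f := fun k => B k i ^ 2) (fun k _ => sq_nonneg _)
      (Finset.mem_univ k)
  exact abs_le.mp (by simpa using h1)

lemma linearCombination_gramCoeff {g N : ℕ} (L : List (Fin g) → ℝ)
    (G : Matrix (ShortWord g N) (ShortWord g N) ℝ) :
    Finsupp.linearCombination ℝ L (gramCoeff g N G) =
      ∑ u, ∑ v, G u v * L (u.1.reverse ++ v.1) := by
  simp [gramCoeff_apply]

/-- A polynomial that is not a hermitian sum of squares is strictly separated from the hermitian
squares of bounded degree. -/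
lemma exists_separating_functional {g : ℕ} (N : ℕ) (a : List (Fin g) →₀ ℝ)
    (ha : ¬ IsHermitianSOS (ofCoeff g a)) :
    ∃ L : List (Fin g) → ℝ,
      (∀ G : Matrix (ShortWord g N) (ShortWord g N) ℝ, G.PosSemidef → G.trace = 1 →
        0 < Finsupp.linearCombination ℝ L (gramCoeff g N G)) ∧
      Finsupp.linearCombination ℝ L a < 0 := by
  classical
  have ha0 : a ≠ 0 := by
    rintro rfl
    exact ha ⟨0, Fin.elim0, by simp⟩
  obtain ⟨w₀, hw₀⟩ := Finsupp.ne_iff.mp ha0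
  rw [Finsupp.zero_apply] at hw₀
  set D := {G : Matrix (ShortWord g N) (ShortWord g N) ℝ | G.PosSemidef ∧ G.trace = 1} with hD
  have hDconv : Convex ℝ D := by
    rintro G ⟨hG, hGt⟩ H ⟨hH, hHt⟩ s t hs ht hst
    refine ⟨(hG.smul hs).add (hH.smul ht), ?_⟩
    simp [hGt, hHt, hst]
  have hDcomp : IsCompact D := isCompact_posSemidef_trace_one _
  let Φ : Matrix (ShortWord g N) (ShortWord g N) ℝ →ₗ[ℝ] (List (Fin g) → ℝ) :=
    Finsupp.lcoeFun ∘ₗ gramCoeff g N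
  have hΦ : Continuous Φ := Φ.continuous_of_finiteDimensional
  let R : Set (List (Fin g) → ℝ) := {q | q = (q w₀ / a w₀) • ⇑a ∧ 0 ≤ q w₀ / a w₀}
  have hRmem : ∀ s : ℝ, 0 ≤ s → s • ⇑a ∈ R := fun s hs => by
    have : (s • ⇑a) w₀ / a w₀ = s := by simp [hw₀]
    simp only [R, Set.mem_ofPred_eq, this]
    exact ⟨trivial, hs⟩
  have hRconv : Convex ℝ R := by
    rintro q ⟨hq, hq0⟩ r ⟨hr, hr0⟩ s t hs ht -
    rw [hq, hr, smul_smul, smul_smul, ← add_smul]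
    exact hRmem _ (by positivity)
  have hRclosed : IsClosed R := by
    have h1 : IsClosed {q : List (Fin g) → ℝ | q = (q w₀ / a w₀) • ⇑a} :=
      isClosed_eq continuous_id (by fun_prop)
    have h2 : IsClosed {q : List (Fin g) → ℝ | 0 ≤ q w₀ / a w₀} :=
      isClosed_le continuous_const (by fun_prop)
    exact h1.inter h2
  have hdisj : Disjoint (Φ '' D) R := by
    rw [Set.disjoint_left]
    rintro _ ⟨G, ⟨hG, hGt⟩, rfl⟩ ⟨hq, hq0⟩
    have hcoe : gramCoeff g N G = (Φ G w₀ / a w₀) • a := DFunLike.coe_injective hq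
    rcases hq0.eq_or_lt with h0 | hpos
    · rw [← h0, zero_smul] at hcoe
      exact one_ne_zero (hGt.symm.trans (gramCoeff_ne_zero hG hcoe))
    · apply ha
      have := isHermitianSOS_gramCoeff (hG.smul (inv_nonneg.mpr hpos.le))
      rwa [map_smul, hcoe, smul_smul, inv_mul_cancel₀ hpos.ne', one_smul] at this
  obtain ⟨f, u, v, hfu, huv, hfv⟩ := geometric_hahn_banach_compact_closed
    (hDconv.linear_image Φ) (hDcomp.image hΦ) hRconv hRclosed hdisj
  have hv : v < 0 := by simpa using hfv _ (hRmem 0 le_rfl)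
  have hfa : 0 ≤ f a := by
    by_contra! hneg
    have := hfv _ (hRmem (v / f a) (div_nonneg_of_nonpos hv.le hneg.le))
    rw [map_smul, smul_eq_mul, div_mul_cancel₀ _ hneg.ne] at this
    exact lt_irrefl _ this
  have hf : ∀ b : List (Fin g) →₀ ℝ,
      Finsupp.linearCombination ℝ (fun w => f (Pi.single w 1)) b = f b := by
    intro b
    induction b using Finsupp.induction_linear with
    | zero => simp
    | add b c hb hc => simp [hb, hc]
    | single w r =>
      rw [Finsupp.linearCombination_single, ← map_smul, Finsupp.single_eq_pi_single,
        ← Pi.single_smul, smul_eq_mul, mul_one]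
  have hcont : Continuous fun G => Finsupp.linearCombination ℝ (⇑a) (gramCoeff g N G) :=
    (Finsupp.linearCombination ℝ (⇑a) ∘ₗ gramCoeff g N).continuous_of_finiteDimensional
  obtain ⟨M, hM⟩ := hDcomp.exists_bound_of_continuousOn hcont.continuousOn
  set ε := -u / (|M| + 1) with hε
  have hεpos : 0 < ε := div_pos (by linarith) (by positivity)
  have hεM : ε * (|M| + 1) = -u := div_mul_cancel₀ _ (by positivity)
  have hL : ∀ b : List (Fin g) →₀ ℝ,
      Finsupp.linearCombination ℝ (fun w => -f (Pi.single w 1) - ε * a w) b =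
        -f b - ε * Finsupp.linearCombination ℝ (⇑a) b := by
    intro b
    rw [← hf]
    simp only [Finsupp.linearCombination_apply, Finsupp.sum, smul_eq_mul, Finset.mul_sum,
      ← Finset.sum_neg_distrib, ← Finset.sum_sub_distrib]
    exact Finset.sum_congr rfl fun _ _ => by ring
  refine ⟨fun w => -f (Pi.single w 1) - ε * a w, fun G hG hGt => ?_, ?_⟩
  · rw [hL]
    have h1 : f (gramCoeff g N G) < u := hfu _ ⟨G, ⟨hG, hGt⟩, rfl⟩
    have h2 := (le_abs_self _).trans ((hM G ⟨hG, hGt⟩).trans (le_abs_self M))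
    nlinarith
  · rw [hL]
    have h3 : 0 < Finsupp.linearCombination ℝ (⇑a) a := by
      simp only [Finsupp.linearCombination_apply, Finsupp.sum, smul_eq_mul]
      refine Finset.sum_pos' (fun w _ => mul_self_nonneg _) ⟨w₀, by simpa using hw₀, ?_⟩
      exact mul_self_pos.mpr hw₀
    nlinarith [mul_pos hεpos h3]

lemma exists_symmetric_positive_functional {g : ℕ} (N : ℕ) (a : List (Fin g) →₀ ℝ)
    (hsym : ∀ w, a w.reverse = a w) (ha : ¬ IsHermitianSOS (ofCoeff g a)) :
    ∃ L : List (Fin g) → ℝ, (∀ w, L w.reverse = L w) ∧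
      (Matrix.of fun u v : ShortWord g N => L (u.1.reverse ++ v.1)).PosDef ∧
      Finsupp.linearCombination ℝ L a < 0 := by
  obtain ⟨L, hpos, hneg⟩ := exists_separating_functional N a ha
  refine ⟨fun w => (L w + L w.reverse) / 2, fun w => by simp [add_comm], ?_, ?_⟩
  · refine PosDef.of_dotProduct_mulVec_pos ?_ fun x hx => ?_
    · ext u v
      simp [add_comm]
    · have hxx : 0 < x ⬝ᵥ x := by simpa using dotProduct_star_self_pos_iff.mpr hx
      have hG : (vecMulVec x x).PosSemidef := by
        simpa using posSemidef_vecMulVec_self_star x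
      have h1 := hpos _ (hG.smul (inv_nonneg.mpr hxx.le))
        (by rw [trace_smul, trace_vecMulVec, smul_eq_mul, inv_mul_cancel₀ hxx.ne'])
      rw [map_smul, map_smul, smul_eq_mul, linearCombination_gramCoeff] at h1
      have h2 := (mul_pos_iff_of_pos_left (inv_pos.mpr hxx)).mp h1
      have h3 : ∑ u, ∑ v, vecMulVec x x u v * L (u.1.reverse ++ v.1) =
          ∑ u, ∑ v, vecMulVec x x u v * L (v.1.reverse ++ u.1) := by
        rw [Finset.sum_comm]
        simp [vecMulVec_apply, mul_comm]
      have h4 : star x ⬝ᵥ (Matrix.of (fun u v : ShortWord g N =>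
          (L (u.1.reverse ++ v.1) + L (u.1.reverse ++ v.1).reverse) / 2)) *ᵥ x =
          (∑ u, ∑ v, vecMulVec x x u v * L (u.1.reverse ++ v.1) +
            ∑ u, ∑ v, vecMulVec x x u v * L (v.1.reverse ++ u.1)) / 2 := by
        simp only [dotProduct, mulVec, vecMulVec_apply, of_apply, star_trivial, Finset.mul_sum,
          ← Finset.sum_add_distrib, Finset.sum_div, List.reverse_append, List.reverse_reverse]
        exact Finset.sum_congr rfl fun u _ => Finset.sum_congr rfl fun v _ => by ring
      rw [h4, ← h3]
      linarith
  · have hrev : Finsupp.linearCombination ℝ (fun w => L w.reverse) a =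
        Finsupp.linearCombination ℝ L a := by
      have ha' : reverseCoeff g a = a := Finsupp.ext fun w => by rw [reverseCoeff_apply, hsym]
      conv_rhs => rw [← ha']
      simp only [reverseCoeff, Finsupp.domLCongr_apply, Finsupp.domCongr_apply,
        Finsupp.linearCombination_equivMapDomain]
      rfl
    have hsplit : Finsupp.linearCombination ℝ (fun w => (L w + L w.reverse) / 2) a =
        (Finsupp.linearCombination ℝ L a +
          Finsupp.linearCombination ℝ (fun w => L w.reverse) a) / 2 := by
      simp only [Finsupp.linearCombination_apply, Finsupp.sum, smul_eq_mul,
        ← Finset.sum_add_distrib, Finset.sum_div]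
      exact Finset.sum_congr rfl fun _ _ => by ring
    rw [hsplit, hrev]
    linarith

/-- A positive definite Hankel-type functional on short words is a vector state of a tuple of
symmetric matrices which acts on a basis indexed by words as the left creation operators do. -/
lemma exists_vector_state {g N : ℕ} (L : List (Fin g) → ℝ) (hrev : ∀ w, L w.reverse = L w)
    (hpos : (Matrix.of fun u v : ShortWord g N => L (u.1.reverse ++ v.1)).PosDef) :
    ∃ (e : ShortWord g N → ShortWord g N → ℝ)
      (Z : Fin g → Matrix (ShortWord g N) (ShortWord g N) ℝ),
      (∀ u v, e u ⬝ᵥ e v = L (u.1.reverse ++ v.1)) ∧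
      (∀ c : ShortWord g N → ℝ, ∃ η, ∀ u, η ⬝ᵥ e u = c u) ∧
      (∀ j, (Z j).IsSymm) ∧
      ∀ j u w, w.1 = j :: u.1 → Z j *ᵥ e u = e w := by
  classical
  obtain ⟨B, hB, hBG⟩ :=
    CStarAlgebra.isStrictlyPositive_iff_eq_star_mul_self.mp hpos.isStrictlyPositive
  rw [star_eq_conjTranspose, conjTranspose_eq_transpose_of_trivial] at hBG
  have hdet : IsUnit B.det := (isUnit_iff_isUnit_det B).mp hB
  let K : Fin g → Matrix (ShortWord g N) (ShortWord g N) ℝ := fun j =>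
    Matrix.of fun u v => L (u.1.reverse ++ j :: v.1)
  refine ⟨fun u => B *ᵥ Pi.single u 1, fun j => B⁻¹ᵀ * K j * B⁻¹, fun u v => ?_, fun c => ?_,
    fun j => ?_, fun j u w h => ?_⟩
  · rw [← of_apply (f := fun u v : ShortWord g N => L (u.1.reverse ++ v.1)), hBG,
      Matrix.mul_apply]
    simp [dotProduct]
  · refine ⟨c ᵥ* B⁻¹, fun u => ?_⟩
    rw [dotProduct_mulVec, vecMul_vecMul, nonsing_inv_mul _ hdet, vecMul_one]
    simp
  · have hK : (K j)ᵀ = K j := by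
      ext u v
      rw [transpose_apply]
      simp only [K, of_apply]
      rw [← hrev]
      simp
    simp only [IsSymm, transpose_mul, transpose_transpose, hK, Matrix.mul_assoc]
  · have hcol : K j *ᵥ Pi.single u 1 = Bᵀ *ᵥ (B *ᵥ Pi.single w 1) := by
      rw [mulVec_mulVec, ← hBG]
      ext v
      simp [K, h]
    rw [mulVec_mulVec, Matrix.mul_assoc, nonsing_inv_mul _ hdet, Matrix.mul_one, ← mulVec_mulVec,
      hcol, mulVec_mulVec, ← transpose_mul, mul_nonsing_inv _ hdet, transpose_one, one_mulVec]

lemma evalMat_freeWord {g : ℕ} {ι : Type} [Fintype ι] [DecidableEq ι]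
    (X : Fin g → Matrix ι ι ℝ) (w : List (Fin g)) :
    evalMat (freeWord w) X = (w.map X).prod := by
  induction w with
  | nil => simp [evalMat]
  | cons j w ih =>
    rw [freeWord_cons, evalMat, map_mul, FreeAlgebra.lift_ι_apply, List.map_cons, List.prod_cons,
      ← ih, evalMat]

lemma evalMat_ofCoeff {g : ℕ} {ι : Type} [Fintype ι] [DecidableEq ι]
    (X : Fin g → Matrix ι ι ℝ) (a : List (Fin g) →₀ ℝ) :
    evalMat (ofCoeff g a) X = Finsupp.linearCombination ℝ (fun w => (w.map X).prod) a := by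
  rw [evalMat, ofCoeff, ← AlgHom.toLinearMap_apply, Finsupp.apply_linearCombination]
  congr 2
  ext1 w
  exact evalMat_freeWord X w

lemma dotProduct_evalMat_mulVec {g : ℕ} {ι : Type} [Fintype ι] [DecidableEq ι]
    (X : Fin g → Matrix ι ι ℝ) (a : List (Fin g) →₀ ℝ) (v : ι → ℝ) :
    v ⬝ᵥ evalMat (ofCoeff g a) X *ᵥ v =
      Finsupp.linearCombination ℝ (fun w => v ⬝ᵥ (w.map X).prod *ᵥ v) a := by
  rw [evalMat_ofCoeff]
  simp only [Finsupp.linearCombination_apply, Finsupp.sum, sum_mulVec, dotProduct_sum,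
    smul_mulVec, dotProduct_smul]

lemma evalMat_star {g : ℕ} {ι : Type} [Fintype ι] [DecidableEq ι]
    {X : Fin g → Matrix ι ι ℝ} (hX : ∀ j, (X j).IsSymm) (p : FreeAlgebra ℝ (Fin g)) :
    evalMat (star p) X = (evalMat p X)ᵀ := by
  unfold evalMat
  induction p using FreeAlgebra.induction with
  | grade0 r => simp [FreeAlgebra.star_algebraMap, Matrix.algebraMap_eq_diagonal]
  | grade1 j => simp [FreeAlgebra.star_ι, (hX j).eq]
  | mul a b ha hb => simp [ha, hb]
  | add a b ha hb => simp [ha, hb]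

lemma evalMat_reindex {g : ℕ} {ι κ : Type} [Fintype ι] [DecidableEq ι] [Fintype κ]
    [DecidableEq κ] (σ : ι ≃ κ) (X : Fin g → Matrix ι ι ℝ) (p : FreeAlgebra ℝ (Fin g)) :
    evalMat p (fun j => reindexAlgEquiv ℝ ℝ σ (X j)) = reindexAlgEquiv ℝ ℝ σ (evalMat p X) := by
  unfold evalMat
  induction p using FreeAlgebra.induction with
  | grade0 r => simp only [AlgHom.commutes, AlgEquiv.commutes]
  | grade1 j => simp only [FreeAlgebra.lift_ι_apply]
  | mul a b ha hb => simp only [map_mul, ha, hb]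
  | add a b ha hb => simp only [map_add, ha, hb]

lemma dotProduct_mulVec_le_sum_abs {ι : Type*} [Fintype ι] (S : Matrix ι ι ℝ) (y : ι → ℝ) :
    y ⬝ᵥ S *ᵥ y ≤ (∑ i, ∑ k, |S i k|) * (y ⬝ᵥ y) := by
  have hle : ∀ i, y i ^ 2 ≤ y ⬝ᵥ y := fun i => by
    rw [dotProduct, sq]
    exact Finset.single_le_sum (f := fun i => y i * y i) (fun i _ => mul_self_nonneg _)
      (Finset.mem_univ i)
  have hexp : y ⬝ᵥ S *ᵥ y = ∑ i, ∑ k, y i * (S i k * y k) := by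
    simp only [dotProduct, mulVec, Finset.mul_sum]
  rw [hexp, Finset.sum_mul]
  refine Finset.sum_le_sum fun i _ => ?_
  rw [Finset.sum_mul]
  refine Finset.sum_le_sum fun k _ => ?_
  have h1 : y i * (S i k * y k) ≤ |S i k| * (|y i| * |y k|) := by
    calc y i * (S i k * y k) ≤ |y i * (S i k * y k)| := le_abs_self _
      _ = |S i k| * (|y i| * |y k|) := by rw [abs_mul, abs_mul]; ring
  refine h1.trans (mul_le_mul_of_nonneg_left ?_ (abs_nonneg _))
  nlinarith [hle i, hle k, sq_nonneg (|y i| - |y k|), sq_abs (y i), sq_abs (y k)]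

/-- A rank one form plus a large multiple of the projection onto the orthogonal complement. -/
def peakForm {ι : Type*} [DecidableEq ι] [Fintype ι] (v : ι → ℝ) (c C : ℝ) : Matrix ι ι ℝ :=
  (c / (v ⬝ᵥ v) ^ 2) • vecMulVec v v + C • (1 - (v ⬝ᵥ v)⁻¹ • vecMulVec v v)

lemma dotProduct_peakForm_mulVec {ι : Type*} [DecidableEq ι] [Fintype ι] (v x : ι → ℝ)
    (c C : ℝ) :
    x ⬝ᵥ peakForm v c C *ᵥ x =
      c / (v ⬝ᵥ v) ^ 2 * (v ⬝ᵥ x) ^ 2 + C * (x ⬝ᵥ x - (v ⬝ᵥ v)⁻¹ * (v ⬝ᵥ x) ^ 2) := by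
  simp only [peakForm, add_mulVec, smul_mulVec, sub_mulVec, one_mulVec, vecMulVec_mulVec,
    dotProduct_add, dotProduct_smul, dotProduct_sub, smul_eq_mul,
    op_smul_eq_smul, dotProduct_comm x v]
  ring

lemma dotProduct_peakForm_mulVec_self {ι : Type*} [DecidableEq ι] [Fintype ι] {v : ι → ℝ}
    (hv : v ≠ 0) (c C : ℝ) : v ⬝ᵥ peakForm v c C *ᵥ v = c := by
  have hn : v ⬝ᵥ v ≠ 0 := by simpa using hv
  rw [dotProduct_peakForm_mulVec]
  field_simp
  ring

lemma exists_peakForm_sub_posDef {ι : Type*} [DecidableEq ι] [Fintype ι] {S : Matrix ι ι ℝ}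
    (hS : S.IsSymm) {v : ι → ℝ} (hv : v ≠ 0) {c : ℝ} (hc : v ⬝ᵥ S *ᵥ v < c) :
    ∃ C₀, ∀ C, C₀ ≤ C → (peakForm v c C - S).PosDef := by
  have hn : 0 < v ⬝ᵥ v := by simpa using dotProduct_star_self_pos_iff.mpr hv
  set m := ∑ i, ∑ k, |S i k|
  set b := (S *ᵥ v) ⬝ᵥ (S *ᵥ v)
  set δ := c - v ⬝ᵥ S *ᵥ v with hδ
  have hδpos : 0 < δ := sub_pos.mpr hc
  refine ⟨m + 2 * b / δ + 1, fun C hC => PosDef.of_dotProduct_mulVec_pos ?_ fun x hx => ?_⟩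
  · rw [IsHermitian, conjTranspose_eq_transpose_of_trivial, transpose_sub, hS.eq]
    simp [peakForm, transpose_vecMulVec]
  set α := (v ⬝ᵥ x) / (v ⬝ᵥ v) with hα
  set y := x - α • v with hy
  have hvx : v ⬝ᵥ x = α * (v ⬝ᵥ v) := by rw [hα]; field_simp
  have hxy : x = y + α • v := by rw [hy]; abel
  have hvy : v ⬝ᵥ y = 0 := by
    rw [hy, dotProduct_sub, dotProduct_smul, hvx, smul_eq_mul, sub_self]
  have hyv : y ⬝ᵥ v = 0 := by rw [dotProduct_comm, hvy]
  have hxx : x ⬝ᵥ x = y ⬝ᵥ y + α ^ 2 * (v ⬝ᵥ v) := by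
    rw [hxy]
    simp only [add_dotProduct, dotProduct_add, smul_dotProduct, dotProduct_smul, hvy, hyv,
      smul_eq_mul]
    ring
  have hsym : v ⬝ᵥ S *ᵥ y = y ⬝ᵥ S *ᵥ v := by
    rw [dotProduct_mulVec, ← mulVec_transpose, hS.eq, dotProduct_comm]
  have hxS : x ⬝ᵥ S *ᵥ x = y ⬝ᵥ S *ᵥ y + 2 * α * (y ⬝ᵥ S *ᵥ v) + α ^ 2 * (v ⬝ᵥ S *ᵥ v) := by
    rw [hxy]
    simp only [mulVec_add, mulVec_smul, add_dotProduct, dotProduct_add, smul_dotProduct,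
      dotProduct_smul, hsym, smul_eq_mul]
    ring
  have hP : x ⬝ᵥ peakForm v c C *ᵥ x = c * α ^ 2 + C * (y ⬝ᵥ y) := by
    rw [dotProduct_peakForm_mulVec, hvx, hxx]
    field_simp
    ring
  rw [star_trivial, sub_mulVec, dotProduct_sub, hP, hxS]
  have hyS := dotProduct_mulVec_le_sum_abs S y
  have hyy : 0 ≤ y ⬝ᵥ y := by simpa using dotProduct_star_self_nonneg y
  have hcs : (y ⬝ᵥ S *ᵥ v) ^ 2 ≤ (y ⬝ᵥ y) * b := by
    simpa [dotProduct, sq, b] using Finset.sum_mul_sq_le_sq_mul_sq Finset.univ y (S *ᵥ v)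
  have hquad : 0 ≤ δ / 2 * α ^ 2 - 2 * α * (y ⬝ᵥ S *ᵥ v) + 2 * b / δ * (y ⬝ᵥ y) := by
    have h1 : 2 / δ * (y ⬝ᵥ S *ᵥ v) ^ 2 ≤ 2 / δ * ((y ⬝ᵥ y) * b) :=
      mul_le_mul_of_nonneg_left hcs (by positivity)
    have h2 : 0 ≤ 2 / δ * (δ / 2 * α - y ⬝ᵥ S *ᵥ v) ^ 2 := by positivity
    have h3 : 2 / δ * (δ / 2 * α - y ⬝ᵥ S *ᵥ v) ^ 2 =
        δ / 2 * α ^ 2 - 2 * α * (y ⬝ᵥ S *ᵥ v) + 2 / δ * (y ⬝ᵥ S *ᵥ v) ^ 2 := by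
      field_simp
      ring
    have h4 : 2 * b / δ * (y ⬝ᵥ y) = 2 / δ * ((y ⬝ᵥ y) * b) := by ring
    linarith
  have hpos : 0 < δ / 2 * α ^ 2 + y ⬝ᵥ y := by
    rcases hyy.eq_or_lt with h0 | h0
    · have hy0 : y = 0 := by simpa using h0.symm
      have hα0 : α ≠ 0 := by
        rintro h
        apply hx
        rw [hxy, hy0, h, zero_smul, add_zero]
      positivity
    · positivity
  have hCy := mul_le_mul_of_nonneg_right hC hyy
  nlinarith

lemma IsQuasiConvex.midpoint_fin {g n : ℕ} {p : FreeAlgebra ℝ (Fin g)} (hsym : star p = p)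
    (hqc : IsQuasiConvex p) {X Y : Fin g → Matrix (Fin n) (Fin n) ℝ}
    (hX : ∀ j, (X j).IsSymm) (hY : ∀ j, (Y j).IsSymm) {v : Fin n → ℝ} (hv : v ≠ 0) {c : ℝ}
    (hc : 0 < c) (hXc : v ⬝ᵥ evalMat p X *ᵥ v < c) (hYc : v ⬝ᵥ evalMat p Y *ᵥ v < c) :
    v ⬝ᵥ evalMat p ((1 / 2 : ℝ) • X + (1 / 2 : ℝ) • Y) *ᵥ v < c := by
  have hn : 0 < n := by
    rcases Nat.eq_zero_or_pos n with rfl | hn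
    · exact absurd (Subsingleton.elim v 0) hv
    · exact hn
  have hsymm : ∀ X : Fin g → Matrix (Fin n) (Fin n) ℝ, (∀ j, (X j).IsSymm) →
      (evalMat p X).IsSymm := fun X hX => by rw [IsSymm, ← evalMat_star hX, hsym]
  obtain ⟨C₀, h₀⟩ := exists_peakForm_sub_posDef (S := 0) transpose_zero hv (c := c) (by simpa)
  obtain ⟨C₁, h₁⟩ := exists_peakForm_sub_posDef (hsymm X hX) hv hXc
  obtain ⟨C₂, h₂⟩ := exists_peakForm_sub_posDef (hsymm Y hY) hv hYc
  set C := max C₀ (max C₁ C₂)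
  have hA : (peakForm v c C).PosDef := by simpa using h₀ C (le_max_left _ _)
  have hmid := (hqc.2 n hn _ hA
    ⟨hX, h₁ C ((le_max_left _ _).trans (le_max_right _ _))⟩
    ⟨hY, h₂ C ((le_max_right _ _).trans (le_max_right _ _))⟩
    (by norm_num : (0 : ℝ) ≤ 1 / 2) (by norm_num : (0 : ℝ) ≤ 1 / 2) (by norm_num)).2
  have h := hmid.dotProduct_mulVec_pos hv
  rw [star_trivial, sub_mulVec, dotProduct_sub, dotProduct_peakForm_mulVec_self hv] at h
  linarith

/-- For a quasi-convex polynomial `p`, the functions `X ↦ ⟨p(X)v, v⟩` are quasi-convex above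
level zero. -/
lemma IsQuasiConvex.midpoint {g : ℕ} {ι : Type} [Fintype ι] [DecidableEq ι]
    {p : FreeAlgebra ℝ (Fin g)} (hsym : star p = p)
    (hqc : IsQuasiConvex p) {X Y : Fin g → Matrix ι ι ℝ}
    (hX : ∀ j, (X j).IsSymm) (hY : ∀ j, (Y j).IsSymm) {v : ι → ℝ} (hv : v ≠ 0) {c : ℝ}
    (hc : 0 < c) (hXc : v ⬝ᵥ evalMat p X *ᵥ v < c) (hYc : v ⬝ᵥ evalMat p Y *ᵥ v < c) :
    v ⬝ᵥ evalMat p ((1 / 2 : ℝ) • X + (1 / 2 : ℝ) • Y) *ᵥ v < c := by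
  let σ := Fintype.equivFin ι
  have key : ∀ W : Fin g → Matrix ι ι ℝ,
      (v ∘ σ.symm) ⬝ᵥ evalMat p (fun j => reindexAlgEquiv ℝ ℝ σ (W j)) *ᵥ (v ∘ σ.symm) =
        v ⬝ᵥ evalMat p W *ᵥ v := fun W => by
    rw [evalMat_reindex, coe_reindexAlgEquiv, reindex_apply, submatrix_mulVec_equiv,
      Equiv.symm_symm, Function.comp_assoc, Equiv.symm_comp_self, Function.comp_id,
      comp_equiv_symm_dotProduct, Function.comp_assoc, Equiv.symm_comp_self, Function.comp_id]
  have hv' : v ∘ σ.symm ≠ 0 := fun h => hv <| by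
    simpa [Function.comp_assoc] using congrArg (· ∘ σ) h
  have hsub : ∀ W : Fin g → Matrix ι ι ℝ, (∀ j, (W j).IsSymm) →
      ∀ j, (reindexAlgEquiv ℝ ℝ σ (W j)).IsSymm := fun W hW j => (hW j).submatrix _
  rw [← key] at hXc hYc ⊢
  have h := hqc.midpoint_fin hsym (hsub X hX) (hsub Y hY) hv' hc hXc hYc
  convert h using 6
  simp only [Pi.add_apply, Pi.smul_apply, map_add, map_smul]

/-- The dilation of `Z` by one dimension with off-diagonal entries `t η`. -/
def dilation {g : ℕ} {ι : Type} (Z : Fin g → Matrix ι ι ℝ) (η : Fin g → ι → ℝ) (t : ℝ)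
    (j : Fin g) : Matrix (ι ⊕ Unit) (ι ⊕ Unit) ℝ :=
  fromBlocks (Z j) (t • replicateCol Unit (η j)) (t • replicateRow Unit (η j)) 0

lemma dilation_isSymm {g : ℕ} {ι : Type} {Z : Fin g → Matrix ι ι ℝ} (hZ : ∀ j, (Z j).IsSymm)
    (η : Fin g → ι → ℝ) (t : ℝ) (j : Fin g) : (dilation Z η t j).IsSymm := by
  simp [IsSymm, dilation, fromBlocks_transpose, (hZ j).eq]

lemma dilation_midpoint {g : ℕ} {ι : Type} (Z : Fin g → Matrix ι ι ℝ) (η : Fin g → ι → ℝ)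
    (t : ℝ) :
    (1 / 2 : ℝ) • dilation Z η t + (1 / 2 : ℝ) • dilation Z η (-t) = dilation Z η 0 := by
  funext j
  simp only [dilation, Pi.add_apply, Pi.smul_apply, fromBlocks_smul, fromBlocks_add, ← add_smul,
    smul_smul]
  norm_num

/-- The two components of a word in the dilation applied to a vector, as polynomials in the
dilation parameter. -/
def dilationPoly {g : ℕ} {ι : Type} [Fintype ι] (Z : Fin g → Matrix ι ι ℝ) (η : Fin g → ι → ℝ)
    (v : ι → ℝ) : List (Fin g) → (ι → Polynomial ℝ) × Polynomial ℝ
  | [] => (fun i => Polynomial.C (v i), 0)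
  | j :: w =>
    let r := dilationPoly Z η v w
    (fun i => ∑ k, Polynomial.C (Z j i k) * r.1 k + Polynomial.X * (Polynomial.C (η j i) * r.2),
      Polynomial.X * ∑ k, Polynomial.C (η j k) * r.1 k)

section DilationPoly

variable {g : ℕ} {ι : Type} [Fintype ι] [DecidableEq ι] (Z : Fin g → Matrix ι ι ℝ)
  (η : Fin g → ι → ℝ) (v : ι → ℝ)

lemma prod_dilation_mulVec (t : ℝ) (w : List (Fin g)) :
    (w.map (dilation Z η t)).prod *ᵥ Sum.elim v 0 =
      Sum.elim (fun i => ((dilationPoly Z η v w).1 i).eval t)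
        (fun _ => (dilationPoly Z η v w).2.eval t) := by
  induction w with
  | nil =>
    ext (i | i) <;> simp [dilationPoly]
  | cons j w ih =>
    rw [List.map_cons, List.prod_cons, ← mulVec_mulVec, ih, dilation, fromBlocks_mulVec]
    ext (i | i)
    · simp [dilationPoly, mulVec, dotProduct, Polynomial.eval_finsetSum, mul_assoc]
    · simp [dilationPoly, mulVec, dotProduct, Polynomial.eval_finsetSum, mul_assoc,
        Finset.mul_sum]

lemma dilationPoly_coeff_zero (w : List (Fin g)) :
    (∀ i, ((dilationPoly Z η v w).1 i).coeff 0 = ((w.map Z).prod *ᵥ v) i) ∧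
      (dilationPoly Z η v w).2.coeff 0 = 0 := by
  induction w with
  | nil => simp [dilationPoly]
  | cons j w ih =>
    refine ⟨fun i => ?_, by simp [dilationPoly]⟩
    rw [List.map_cons, List.prod_cons, ← mulVec_mulVec]
    simp [dilationPoly, mulVec, dotProduct, ih.1]

lemma dilationPoly_fst_coeff_one (w : List (Fin g)) (i : ι) :
    ((dilationPoly Z η v w).1 i).coeff 1 = 0 := by
  induction w generalizing i with
  | nil => simp [dilationPoly]
  | cons j w ih =>
    simp [dilationPoly, Polynomial.coeff_X_mul, ih, (dilationPoly_coeff_zero Z η v w).2]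

lemma dilationPoly_cons_snd_coeff_one (j : Fin g) (w : List (Fin g)) :
    (dilationPoly Z η v (j :: w)).2.coeff 1 = η j ⬝ᵥ ((w.map Z).prod *ᵥ v) := by
  simp [dilationPoly, Polynomial.coeff_X_mul, dotProduct, (dilationPoly_coeff_zero Z η v w).1]

omit [DecidableEq ι] in
lemma dilationPoly_cons_fst_coeff_two (j : Fin g) (w : List (Fin g)) (i : ι) :
    ((dilationPoly Z η v (j :: w)).1 i).coeff 2 =
      ∑ k, Z j i k * ((dilationPoly Z η v w).1 k).coeff 2 +
        η j i * (dilationPoly Z η v w).2.coeff 1 := by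
  simp [dilationPoly, Polynomial.coeff_X_mul]

end DilationPoly

/-- Sum of `c u * c b` over the splittings of `s.reverse ++ w` as `u.reverse ++ b` with `u` longer
than `s`. -/
def splitSum {g : ℕ} (c : List (Fin g) → ℝ) : List (Fin g) → List (Fin g) → ℝ
  | _, [] => 0
  | s, j :: w => splitSum c (j :: s) w + c (j :: s) * c w

lemma splitSum_eq_sum {g : ℕ} {c : List (Fin g) → ℝ} {S : Finset (List (Fin g))}
    (hS : ∀ u, u ∉ S → c u = 0) (s w : List (Fin g)) :
    splitSum c s w = ∑ u ∈ S, ∑ b ∈ S,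
      if u.reverse ++ b = s.reverse ++ w ∧ s.length < u.length then c u * c b else 0 := by
  induction w generalizing s with
  | nil =>
    refine (Finset.sum_eq_zero fun u _ => Finset.sum_eq_zero fun b _ => if_neg ?_).symm
    rintro ⟨h, hlt⟩
    have := congrArg List.length h
    simp at this
    omega
  | cons j w ih =>
    have hone : c (j :: s) * c w =
        ∑ u ∈ S, ∑ b ∈ S, if u = j :: s ∧ b = w then c u * c b else 0 := by
      simp only [ite_and, Finset.sum_ite_irrel, Finset.sum_const_zero, Finset.sum_ite_eq']
      split_ifs with h1 h2
      · rfl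
      · rw [hS _ h2, mul_zero]
      · rw [hS _ h1, zero_mul]
    rw [splitSum, ih, hone, ← Finset.sum_add_distrib]
    refine Finset.sum_congr rfl fun u _ => ?_
    rw [← Finset.sum_add_distrib]
    refine Finset.sum_congr rfl fun b _ => ?_
    have hrev : (j :: s).reverse ++ w = s.reverse ++ j :: w := by simp
    rw [hrev]
    by_cases hub : u = j :: s ∧ b = w
    · obtain ⟨rfl, rfl⟩ := hub
      simp
    · rw [if_neg hub, add_zero]
      refine if_congr ?_ rfl rfl
      refine and_congr_right fun h => ⟨fun hlt => ?_, fun hlt => ?_⟩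
      · simp only [List.length_cons] at hlt
        omega
      · rw [← hrev] at h
        rcases (Nat.succ_le_of_lt hlt).eq_or_lt with heq | h'
        · obtain ⟨h1, h2⟩ := List.append_inj h (by simpa using heq.symm)
          exact absurd ⟨List.reverse_injective h1, h2⟩ hub
        · simpa using h'

/-- A real polynomial without linear term and with negative quadratic coefficient drops below its
value at the origin at a pair of opposite points. -/
lemma exists_eval_lt_of_coeff_two_neg {f : Polynomial ℝ} (h1 : f.coeff 1 = 0)
    (h2 : f.coeff 2 < 0) : ∃ t, f.eval t < f.eval 0 ∧ f.eval (-t) < f.eval 0 := by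
  have hf : ∀ t, f.eval t = f.eval 0 + t ^ 2 * f.divX.divX.eval t := by
    intro t
    have e1 := congrArg (Polynomial.eval t) (Polynomial.divX_mul_X_add f)
    have e2 := congrArg (Polynomial.eval t) (Polynomial.divX_mul_X_add f.divX)
    simp only [Polynomial.eval_add, Polynomial.eval_mul, Polynomial.eval_X, Polynomial.eval_C,
      Polynomial.coeff_divX, zero_add, h1] at e1 e2
    rw [← Polynomial.coeff_zero_eq_eval_zero, ← e1, ← e2]
    ring
  have h0 : f.divX.divX.eval 0 < 0 := by
    rwa [← Polynomial.coeff_zero_eq_eval_zero, Polynomial.coeff_divX, Polynomial.coeff_divX]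
  have hnhds : ∀ᶠ t in nhds (0 : ℝ), f.divX.divX.eval t < 0 :=
    f.divX.divX.continuous.continuousAt.eventually_lt continuousAt_const h0
  obtain ⟨r, hr, hball⟩ := Metric.eventually_nhds_iff.mp hnhds
  have ht : 0 < (r / 2) ^ 2 := by positivity
  refine ⟨r / 2, ?_, ?_⟩
  · rw [hf (r / 2)]
    have := hball (y := r / 2) (by simp [abs_of_pos hr]; linarith)
    nlinarith
  · rw [hf (-(r / 2)), neg_sq]
    have := hball (y := -(r / 2)) (by simp [abs_of_pos hr]; linarith)
    nlinarith

/-- For a quasi-convex polynomial whose negative is not a hermitian sum of squares, the Hankel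
form of its coefficients is nonnegative off the empty word. -/
lemma IsQuasiConvex.hankel_nonneg {g : ℕ} {a : List (Fin g) →₀ ℝ}
    (hsym : ∀ w, a w.reverse = a w) (hqc : IsQuasiConvex (ofCoeff g a))
    (hsos : ¬ IsHermitianSOS (-ofCoeff g a)) {S : Finset (List (Fin g))} (hS : [] ∉ S)
    (c : List (Fin g) → ℝ) :
    0 ≤ ∑ u ∈ S, ∑ b ∈ S, c u * c b * a (u.reverse ++ b) := by
  classical
  obtain ⟨N, hN⟩ : ∃ N, ∀ w ∈ a.support, w.length ≤ N :=
    ⟨a.support.sup List.length, fun w hw => Finset.le_sup (f := List.length) hw⟩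
  obtain ⟨L, hLrev, hLpos, hLneg⟩ := exists_symmetric_positive_functional N (-a)
    (fun w => by simp [hsym]) (by rwa [map_neg])
  rw [map_neg, neg_lt_zero] at hLneg
  obtain ⟨e, Z, he, hη, hZ, hZe⟩ := exists_vector_state L hLrev hLpos
  set c' : List (Fin g) → ℝ := fun u => if u ∈ S then c u else 0 with hc'
  choose η hη using fun j => hη fun u => c' (j :: u.1)
  let o : ShortWord g N := ⟨[], Nat.zero_le N⟩
  have hword : ∀ w (h : w.length ≤ N), (w.map Z).prod *ᵥ e o = e ⟨w, h⟩ := by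
    intro w
    induction w with
    | nil => intro h; simp [o]
    | cons j w ih =>
      intro h
      have hw : w.length ≤ N := (Nat.le_succ _).trans h
      rw [List.map_cons, List.prod_cons, ← mulVec_mulVec, ih hw]
      exact hZe j ⟨w, hw⟩ ⟨j :: w, h⟩ rfl
  let P := dilationPoly Z η (e o)
  have hsnd : ∀ w : List (Fin g), w.length ≤ N → (P w).2.coeff 1 = c' w := by
    intro w hw
    cases w with
    | nil => simp [P, dilationPoly, hc', hS]
    | cons j w =>
      rw [dilationPoly_cons_snd_coeff_one, hword w ((Nat.le_succ _).trans hw), hη]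
  have hfst : ∀ w s : List (Fin g), ∀ h : s.length + w.length ≤ N,
      e ⟨s, le_of_add_le_left h⟩ ⬝ᵥ (fun i => ((P w).1 i).coeff 2) = splitSum c' s w := by
    intro w
    induction w with
    | nil => intro s h; simp [P, dilationPoly, splitSum, dotProduct]
    | cons j w ih =>
      intro s h
      have hs : s.length ≤ N := le_of_add_le_left h
      simp only [List.length_cons] at h
      have hjs : (j :: s).length ≤ N := by simp only [List.length_cons]; omega
      have hvec : (fun i => ((P (j :: w)).1 i).coeff 2) =
          Z j *ᵥ (fun k => ((P w).1 k).coeff 2) + c' w • η j := by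
        funext i
        rw [dilationPoly_cons_fst_coeff_two, hsnd w (by omega)]
        simp [mulVec, dotProduct, P, mul_comm]
      rw [hvec, dotProduct_add, dotProduct_smul, dotProduct_comm _ (η j), hη, dotProduct_mulVec,
        ← mulVec_transpose, (hZ j).eq, hZe j ⟨s, hs⟩ ⟨j :: s, hjs⟩ rfl,
        ih (j :: s) (by simp only [List.length_cons]; omega), splitSum, smul_eq_mul, mul_comm]
  let f : Polynomial ℝ := ∑ w ∈ a.support, ∑ i, Polynomial.C (a w * e o i) * (P w).1 i
  have hfeval : ∀ t, f.eval t = Sum.elim (e o) 0 ⬝ᵥ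
      evalMat (ofCoeff g a) (dilation Z η t) *ᵥ Sum.elim (e o) 0 := by
    intro t
    rw [dotProduct_evalMat_mulVec]
    simp only [prod_dilation_mulVec, Finsupp.linearCombination_apply, Finsupp.sum, f,
      Polynomial.eval_finsetSum, sumElim_dotProduct_sumElim, zero_dotProduct, add_zero]
    simp [dotProduct, Finset.mul_sum, mul_assoc, P]
  have hf0 : f.eval 0 = Finsupp.linearCombination ℝ L a := by
    rw [← Polynomial.coeff_zero_eq_eval_zero]
    simp only [f, Polynomial.finsetSum_coeff, Polynomial.coeff_C_mul, P,
      (dilationPoly_coeff_zero Z η (e o) _).1, Finsupp.linearCombination_apply, Finsupp.sum]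
    refine Finset.sum_congr rfl fun w hw => ?_
    rw [hword w (hN w hw), smul_eq_mul]
    simpa [dotProduct, Finset.mul_sum, mul_assoc, o] using congrArg (a w * ·) (he o ⟨w, hN w hw⟩)
  have hf1 : f.coeff 1 = 0 := by
    simp only [f, Polynomial.finsetSum_coeff, Polynomial.coeff_C_mul, P,
      dilationPoly_fst_coeff_one, mul_zero, Finset.sum_const_zero]
  have hf2 : f.coeff 2 = ∑ w ∈ a.support, a w * splitSum c' [] w := by
    simp only [f, Polynomial.finsetSum_coeff, Polynomial.coeff_C_mul]
    refine Finset.sum_congr rfl fun w hw => ?_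
    rw [← hfst w [] (by simpa using hN w hw)]
    simp [dotProduct, Finset.mul_sum, mul_assoc, o]
  have hstar : star (ofCoeff g a) = ofCoeff g a := by
    rw [star_ofCoeff]
    exact congrArg _ (Finsupp.ext fun w => by rw [reverseCoeff_apply, hsym])
  have heo : Sum.elim (e o) (0 : Unit → ℝ) ≠ 0 := by
    intro h
    have h0 : e o = 0 := by simpa using congrArg (· ∘ Sum.inl) h
    refine hLneg.ne' ?_
    rw [← hf0, hfeval, h0]
    simp
  have hnonneg : 0 ≤ f.coeff 2 := by
    by_contra! hneg
    obtain ⟨t, ht, ht'⟩ := exists_eval_lt_of_coeff_two_neg hf1 hneg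
    have hpos : 0 < f.eval 0 := by rwa [hf0]
    rw [hfeval t, hfeval 0] at ht
    rw [hfeval (-t), hfeval 0] at ht'
    rw [hfeval 0] at hpos
    have := hqc.midpoint hstar (dilation_isSymm hZ η t) (dilation_isSymm hZ η (-t)) heo hpos
      ht ht'
    rw [dilation_midpoint] at this
    exact lt_irrefl _ this
  rw [hf2] at hnonneg
  refine hnonneg.trans_eq ?_
  simp only [splitSum_eq_sum (c := c') (S := S) (fun u hu => if_neg hu), Finset.mul_sum]
  rw [Finset.sum_comm]
  refine Finset.sum_congr rfl fun u hu => ?_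
  rw [Finset.sum_comm]
  refine Finset.sum_congr rfl fun b hb => ?_
  have hu0 : 0 < u.length := List.length_pos_iff.mpr (ne_of_mem_of_not_mem hu hS)
  simpa [hu0, hc', hu, hb, mul_comm] using Or.inr

lemma freeWord_singleton_mem_degOne {g : ℕ} (i : Fin g) : freeWord [i] ∈ degOne g :=
  Submodule.subset_span ⟨i, by simp [freeWord]⟩

lemma degOne_pow_le_degLE {g k i : ℕ} (hi : i ≤ k) : degOne g ^ i ≤ degLE g k :=
  le_iSup₂_of_le (f := fun i (_ : i ∈ Finset.range (k + 1)) => degOne g ^ i) i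
    (Finset.mem_range_succ_iff.mpr hi) le_rfl

lemma coeff_eq_zero_of_hankel_nonneg {g : ℕ} {a : List (Fin g) →₀ ℝ}
    (hsym : ∀ w, a w.reverse = a w)
    (hpos : ∀ S : Finset (List (Fin g)), [] ∉ S → ∀ c : List (Fin g) → ℝ,
      0 ≤ ∑ u ∈ S, ∑ b ∈ S, c u * c b * a (u.reverse ++ b))
    {w : List (Fin g)} (hw : 3 ≤ w.length) : a w = 0 := by
  classical
  by_contra hne
  obtain ⟨z, hz, hmax⟩ := Finset.exists_max_image a.support List.length
    ⟨w, Finsupp.mem_support_iff.mpr hne⟩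
  have hz3 : 3 ≤ z.length := hw.trans (hmax w (Finsupp.mem_support_iff.mpr hne))
  have hz0 : a z ≠ 0 := Finsupp.mem_support_iff.mp hz
  obtain _ | ⟨i, y⟩ := z
  · simp at hz3
  simp only [List.length_cons] at hz3 hmax
  have hlong : a (y.reverse ++ y) = 0 := by
    by_contra h
    have := hmax _ (Finsupp.mem_support_iff.mpr h)
    simp only [List.length_append, List.length_reverse] at this
    omega
  have hrev : a (y.reverse ++ [i]) = a (i :: y) := by rw [← hsym (i :: y), List.reverse_cons]
  have hiy : [i] ≠ y := by
    rintro rfl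
    simp at hz3
  have hy0 : y ≠ [] := by
    rintro rfl
    simp at hz3
  have h := hpos {[i], y} (by simp [hy0.symm])
    (fun u => if u = y then -(a [i, i] + 1) / (2 * a (i :: y)) else 1)
  rw [Finset.sum_pair hiy, Finset.sum_pair hiy, Finset.sum_pair hiy] at h
  simp only [hiy, if_true, if_false, hlong, hrev, List.reverse_singleton,
    List.singleton_append] at h
  have hval : -(a [i, i] + 1) / (2 * a (i :: y)) * a (i :: y) = -(a [i, i] + 1) / 2 := by
    field_simp
  simp only [one_mul, mul_one, mul_zero, add_zero, hval] at h
  linarith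

lemma posSemidef_of_hankel_nonneg {g : ℕ} {a : List (Fin g) →₀ ℝ}
    (hsym : ∀ w, a w.reverse = a w)
    (hpos : ∀ S : Finset (List (Fin g)), [] ∉ S → ∀ c : List (Fin g) → ℝ,
      0 ≤ ∑ u ∈ S, ∑ b ∈ S, c u * c b * a (u.reverse ++ b)) :
    (Matrix.of fun i j : Fin g => a [i, j]).PosSemidef := by
  classical
  refine PosSemidef.of_dotProduct_mulVec_nonneg ?_ fun x => ?_
  · ext i j
    simpa using hsym [i, j]
  · have hinj : Function.Injective fun i : Fin g => [i] := List.singleton_injective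
    have h := hpos (Finset.univ.map ⟨_, hinj⟩) (by simp) (fun u => (u.map x).sum)
    simp only [Finset.sum_map, Function.Embedding.coeFn_mk, List.map_singleton,
      List.sum_singleton, List.reverse_singleton, List.singleton_append] at h
    refine h.trans_eq ?_
    simp only [dotProduct, mulVec, star_trivial, Finset.mul_sum, of_apply]
    exact Finset.sum_congr rfl fun i _ => Finset.sum_congr rfl fun j _ => by ring

lemma coeff_eq_of_length_le_two {g : ℕ} {a : List (Fin g) →₀ ℝ} (hnil : a [] = 0)
    (hlong : ∀ w : List (Fin g), 3 ≤ w.length → a w = 0) :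
    a = ∑ i, Finsupp.single [i] (a [i]) + ∑ i, ∑ j, Finsupp.single [i, j] (a [i, j]) := by
  classical
  ext w
  match w with
  | [] => simp [hnil]
  | [k] => simp [Finsupp.single_apply]
  | [k, l] =>
    simp [Finsupp.single_apply, ite_and]
  | k :: l :: m :: w => simp [hlong]

/-- If `p` is a symmetric quasi-convex free polynomial, then either `-p` is a
hermitian sum of squares, or `p = ℓ + Σⱼ sⱼ* sⱼ` with `ℓ` and the `sⱼ` homogeneous of degree
one; in the second case `p` has degree at most two. -/
theorem stmt_0 (g : ℕ) (p : FreeAlgebra ℝ (Fin g))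
    (hsym : star p = p) (hqc : IsQuasiConvex p) :
    IsHermitianSOS (-p) ∨
      ∃ (l : FreeAlgebra ℝ (Fin g)) (m : ℕ) (s : Fin m → FreeAlgebra ℝ (Fin g)),
        l ∈ degOne g ∧ (∀ j, s j ∈ degOne g) ∧
        p = l + ∑ j, star (s j) * s j ∧ p ∈ degLE g 2 := by
  classical
  by_cases hsos : IsHermitianSOS (-p)
  · exact Or.inl hsos
  right
  obtain ⟨a, hasym, rfl⟩ := exists_symmetric_coeff p hsym
  have hpos : ∀ S : Finset (List (Fin g)), [] ∉ S → ∀ c : List (Fin g) → ℝ,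
      0 ≤ ∑ u ∈ S, ∑ b ∈ S, c u * c b * a (u.reverse ++ b) :=
    fun S hS c => hqc.hankel_nonneg hasym hsos hS c
  have hnil : a [] = 0 := by
    have h := congrFun (congrFun (hqc.1 1) 0) 0
    rw [evalMat_ofCoeff, Finsupp.linearCombination_apply,
      Finsupp.sum_eq_single (a := [])] at h
    · simpa using h
    · intro w _ hw
      obtain _ | ⟨j, w⟩ := w
      · exact absurd rfl hw
      · simp
    · simp
  obtain ⟨B, hB⟩ := CStarAlgebra.nonneg_iff_eq_star_mul_self.mp
    (posSemidef_of_hankel_nonneg hasym hpos).nonneg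
  have hBa : ∀ i j, a [i, j] = ∑ k, B k i * B k j := fun i j => by
    rw [← of_apply (f := fun i j : Fin g => a [i, j]), hB]
    simp [star_eq_conjTranspose, Matrix.mul_apply]
  have hl : ∑ i, a [i] • freeWord [i] ∈ degOne g :=
    Submodule.sum_mem _ fun i _ => Submodule.smul_mem _ _ (freeWord_singleton_mem_degOne i)
  have hs : ∀ k, ∑ i, B k i • freeWord [i] ∈ degOne g := fun k =>
    Submodule.sum_mem _ fun i _ => Submodule.smul_mem _ _ (freeWord_singleton_mem_degOne i)
  have hstar : ∀ k, star (∑ i, B k i • freeWord [i]) = ∑ i, B k i • freeWord [i] := fun k => by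
    simp [star_sum, star_real_smul, star_freeWord]
  have hp : ofCoeff g a = ∑ i, a [i] • freeWord [i] +
      ∑ k, star (∑ i, B k i • freeWord [i]) * ∑ i, B k i • freeWord [i] := by
    conv_lhs => rw [coeff_eq_of_length_le_two hnil
      fun w hw => coeff_eq_zero_of_hankel_nonneg hasym hpos hw]
    simp only [map_add, map_sum, ofCoeff_single, hstar, Finset.sum_mul_sum, smul_mul_smul_comm,
      ← freeWord_append, List.singleton_append, hBa, Finset.sum_smul]
    rw [Finset.sum_comm_cycle]
  refine ⟨_, g, _, hl, hs, hp, ?_⟩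
  rw [hp]
  refine add_mem (degOne_pow_le_degLE one_le_two ((pow_one (degOne g)).symm ▸ hl)) ?_
  refine Submodule.sum_mem _ fun k _ => degOne_pow_le_degLE le_rfl ?_
  rw [hstar, pow_two]
  exact Submodule.mul_mem_mul (hs k) (hs k)
end
end

section
/- Let p ∈ ℝ⟨x⟩ be a symmetric free polynomial that is quasi-convex. If there exists a positive integer N such that for every n ≥ N there is a real symmetric n×n matrix B that is not positive semidefinite and for which the set {X ∈ 𝕊ₙ(ℝ^g) : B − p(X) is positive definite} is convex, then −p is a hermitian sum of squares if and only if p = 0. -/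
open scoped BigOperators

noncomputable section

/-! ### Real Pauli matrices -/

/-- The nontrivial real character of `ℤ/2`. -/
def zmodSign (z : ZMod 2) : ℝ := if z = 0 then 1 else -1

lemma zmodSign_zero : zmodSign 0 = 1 := by simp [zmodSign]

lemma zmodSign_add (x y : ZMod 2) : zmodSign (x + y) = zmodSign x * zmodSign y := by
  have h01 : ∀ z : ZMod 2, z = 0 ∨ z = 1 := by decide
  have h11 : (1 + 1 : ZMod 2) = 0 := by decide
  rcases h01 x with rfl | rfl <;> rcases h01 y with rfl | rfl <;> simp [zmodSign, h11]

lemma zmodSign_mul_self (x : ZMod 2) : zmodSign x * zmodSign x = 1 := by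
  unfold zmodSign; split_ifs <;> norm_num

lemma zmodSign_eq (x : ZMod 2) : zmodSign x = 1 ∨ zmodSign x = -1 := by
  unfold zmodSign; split_ifs <;> simp

lemma zmodSign_sum {α : Type*} (s : Finset α) (f : α → ZMod 2) :
    zmodSign (∑ i ∈ s, f i) = ∏ i ∈ s, zmodSign (f i) := by
  classical
  induction s using Finset.induction_on with
  | empty => simp [zmodSign_zero]
  | insert a s ha ih => rw [Finset.sum_insert ha, Finset.prod_insert ha, zmodSign_add, ih]

lemma sum_zmodSign_dotProduct {k : ℕ} (x : Fin k → ZMod 2) :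
    ∑ b : Fin k → ZMod 2, zmodSign (b ⬝ᵥ x) = if x = 0 then (2 : ℝ) ^ k else 0 := by
  have h : ∑ b : Fin k → ZMod 2, zmodSign (b ⬝ᵥ x) = ∏ i, ∑ z : ZMod 2, zmodSign (z * x i) := by
    rw [Finset.prod_univ_sum, Fintype.piFinset_univ]
    exact Finset.sum_congr rfl fun b _ => zmodSign_sum _ _
  have h2 : ∀ y : ZMod 2, ∑ z : ZMod 2, zmodSign (z * y) = if y = 0 then (2 : ℝ) else 0 := by
    intro y
    have h3 : (Finset.univ : Finset (ZMod 2)) = {0, 1} := by decide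
    rw [h3, Finset.sum_pair (by decide)]
    have h01 : ∀ z : ZMod 2, z = 0 ∨ z = 1 := by decide
    rcases h01 y with rfl | rfl <;> norm_num [zmodSign]
  rw [h]
  simp_rw [h2]
  split_ifs with hx
  · simp [hx]
  · obtain ⟨i, hi⟩ := Function.ne_iff.mp hx
    exact Finset.prod_eq_zero (Finset.mem_univ i) (if_neg hi)

/-- The product of the translation by `a` with the multiplication by the character given by `b`,
acting on functions on `(ℤ/2)ᵏ`. -/
def pauli {k : ℕ} (a b : Fin k → ZMod 2) : Matrix (Fin k → ZMod 2) (Fin k → ZMod 2) ℝ :=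
  Matrix.of fun u v => if u = v + a then zmodSign (b ⬝ᵥ v) else 0

lemma pauli_mul {k : ℕ} (a b a' b' : Fin k → ZMod 2) :
    pauli a b * pauli a' b' = zmodSign (b ⬝ᵥ a') • pauli (a + a') (b + b') := by
  ext u v
  simp only [pauli, Matrix.mul_apply, Matrix.of_apply, Matrix.smul_apply, smul_eq_mul, mul_ite,
    mul_zero]
  rw [Finset.sum_ite_eq' Finset.univ (v + a')]
  simp only [Finset.mem_univ, if_true]
  rw [add_assoc, add_comm a' a]
  split_ifs
  · rw [dotProduct_add, add_dotProduct, zmodSign_add, zmodSign_add]; ring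
  · simp

lemma pauli_transpose {k : ℕ} (a b : Fin k → ZMod 2) :
    (pauli a b).transpose = zmodSign (b ⬝ᵥ a) • pauli a b := by
  ext u v
  simp only [pauli, Matrix.transpose_apply, Matrix.of_apply, Matrix.smul_apply, smul_eq_mul]
  have haa : a + a = 0 := funext fun i => CharTwo.add_self_eq_zero (a i)
  by_cases h : u = v + a
  · have h' : v = u + a := by rw [h, add_assoc, haa, add_zero]
    rw [if_pos h, if_pos h', h, dotProduct_add, zmodSign_add, mul_comm]
  · have h' : ¬ v = u + a := fun h' => h (by rw [h', add_assoc, haa, add_zero])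
    rw [if_neg h, if_neg h', mul_zero]

lemma pauli_zero {k : ℕ} : pauli (0 : Fin k → ZMod 2) 0 = 1 := by
  ext u v
  simp [pauli, Matrix.one_apply, zmodSign_zero]

lemma pauli_transpose_mul_self {k : ℕ} (a b : Fin k → ZMod 2) :
    (pauli a b).transpose * pauli a b = 1 := by
  have h : ∀ c : Fin k → ZMod 2, c + c = 0 := fun c =>
    funext fun i => CharTwo.add_self_eq_zero (c i)
  rw [pauli_transpose, smul_mul_assoc, pauli_mul, smul_smul, zmodSign_mul_self, one_smul, h, h,
    pauli_zero]

lemma single_eq_sum_pauli {k : ℕ} (u v : Fin k → ZMod 2) :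
    Matrix.single u v (1 : ℝ) =
      ((2 : ℝ) ^ k)⁻¹ • ∑ b : Fin k → ZMod 2, zmodSign (b ⬝ᵥ v) • pauli (u - v) b := by
  ext x y
  simp only [Matrix.smul_apply, Matrix.sum_apply, pauli, Matrix.of_apply, smul_eq_mul, mul_ite,
    mul_zero]
  by_cases h : x = y + (u - v)
  · simp only [if_pos h, ← zmodSign_add, ← dotProduct_add, sum_zmodSign_dotProduct]
    have hvy : v + y = 0 ↔ v = y := by
      rw [add_eq_zero_iff_eq_neg, show -y = y from funext fun i => CharTwo.neg_eq (y i)]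
    rw [Matrix.single_apply]
    by_cases hy : v = y
    · subst hy
      have : u = x := by rw [h]; abel
      rw [if_pos ⟨this, rfl⟩, if_pos (hvy.2 rfl), inv_mul_cancel₀ (by positivity)]
    · rw [if_neg (fun h => hy h.2), if_neg (fun h => hy (hvy.1 h)), mul_zero]
  · simp only [if_neg h, Finset.sum_const_zero, mul_zero]
    rw [Matrix.single_apply, if_neg]
    rintro ⟨rfl, rfl⟩
    exact h (by abel)

lemma mem_span_pauli {k : ℕ} (A : Matrix (Fin k → ZMod 2) (Fin k → ZMod 2) ℝ) :
    A ∈ Submodule.span ℝ {M | ∃ a b : Fin k → ZMod 2, M = pauli a b} := by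
  rw [Matrix.matrix_eq_sum_single A]
  refine Submodule.sum_mem _ fun u _ => Submodule.sum_mem _ fun v _ => ?_
  have : Matrix.single u v (A u v) = A u v • Matrix.single u v (1 : ℝ) := by
    rw [Matrix.smul_single, smul_eq_mul, mul_one]
  rw [this, single_eq_sum_pauli]
  exact Submodule.smul_mem _ _ (Submodule.smul_mem _ _ (Submodule.sum_mem _ fun b _ =>
    Submodule.smul_mem _ _ (Submodule.subset_span ⟨_, _, rfl⟩)))

lemma mem_span_symm_pauli {k : ℕ} {A : Matrix (Fin k → ZMod 2) (Fin k → ZMod 2) ℝ}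
    (hA : A.IsSymm) :
    A ∈ Submodule.span ℝ
      {M | M.IsSymm ∧ ∃ a b : Fin k → ZMod 2, M = pauli a b} := by
  have key : ∀ C : Matrix (Fin k → ZMod 2) (Fin k → ZMod 2) ℝ, C + C.transpose ∈
      Submodule.span ℝ {M | M.IsSymm ∧ ∃ a b : Fin k → ZMod 2, M = pauli a b} := by
    intro C
    induction mem_span_pauli C using Submodule.span_induction with
    | mem M hM =>
      obtain ⟨a, b, rfl⟩ := hM
      rcases zmodSign_eq (b ⬝ᵥ a) with h | h
      · have hs : (pauli a b).transpose = pauli a b := by rw [pauli_transpose, h, one_smul]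
        rw [hs]
        exact add_mem (Submodule.subset_span ⟨hs, a, b, rfl⟩)
          (Submodule.subset_span ⟨hs, a, b, rfl⟩)
      · rw [pauli_transpose, h, neg_one_smul, add_neg_cancel]
        exact zero_mem _
    | zero => simp
    | add x y _ _ hx hy =>
      rw [Matrix.transpose_add, add_add_add_comm]
      exact add_mem hx hy
    | smul c x _ hx =>
      rw [Matrix.transpose_smul, ← smul_add]
      exact Submodule.smul_mem _ _ hx
  have h := Submodule.smul_mem _ (2⁻¹ : ℝ) (key A)
  rwa [hA.eq, ← two_smul ℝ A, smul_smul, inv_mul_cancel₀ two_ne_zero, one_smul] at h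

/-! ### Faithfulness of evaluation on symmetric matrices -/

lemma freeAlgebra_lift_eq_sum {g : ℕ} {A : Type*} [Semiring A] [Algebra ℝ A] (X : Fin g → A)
    (h : FreeAlgebra ℝ (Fin g)) :
    FreeAlgebra.lift ℝ X h =
      (FreeAlgebra.equivMonoidAlgebraFreeMonoid h).coeff.sum
        fun w c => c • (w.toList.map X).prod := by
  have key : FreeAlgebra.lift ℝ X =
      (MonoidAlgebra.lift ℝ A (FreeMonoid (Fin g)) (FreeMonoid.lift X)).comp
        (FreeAlgebra.equivMonoidAlgebraFreeMonoid
          (R := ℝ) (X := Fin g)).toAlgHom := by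
    ext j
    simp [FreeAlgebra.equivMonoidAlgebraFreeMonoid]
  rw [key]
  simp [MonoidAlgebra.lift_apply, FreeMonoid.lift_apply]

/-- Weighted adjacency matrices of a path whose edges are coloured by the letters of `w`; the
vertices are placed by `ν`. -/
def pathMat {g : ℕ} {V : Type} (ν : V → ℕ) (w : List (Fin g)) (j : Fin g) : Matrix V V ℝ :=
  Matrix.of fun u v =>
    if (ν v = ν u + 1 ∧ w[ν u]? = some j) ∨ (ν u = ν v + 1 ∧ w[ν v]? = some j) then 1 else 0

lemma pathMat_apply {g : ℕ} {V : Type} (ν : V → ℕ) (w : List (Fin g)) (j : Fin g) (u v : V) :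
    pathMat ν w j u v = if (ν v = ν u + 1 ∧ w[ν u]? = some j) ∨
      (ν u = ν v + 1 ∧ w[ν v]? = some j) then 1 else 0 := rfl

lemma pathMat_isSymm {g : ℕ} {V : Type} (ν : V → ℕ) (w : List (Fin g)) (j : Fin g) :
    (pathMat ν w j).IsSymm := by
  ext u v
  simp only [pathMat, Matrix.transpose_apply, Matrix.of_apply, or_comm]

lemma prod_pathMat_apply {g : ℕ} {V : Type} [Fintype V] [DecidableEq V] {ν : V → ℕ}
    (hν : Function.Injective ν) (w : List (Fin g)) (hsurj : ∀ i ≤ w.length, ∃ v, ν v = i)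
    {z : V} (hz : ν z = w.length) (ε : ℝ) (l : List (Fin g)) (u : V)
    (hu : ν u + l.length ≤ w.length) :
    (l.map fun j => ε • pathMat ν w j).prod u z =
      if l = w.drop (ν u) then ε ^ l.length else 0 := by
  induction l generalizing u with
  | nil =>
    simp only [List.map_nil, List.prod_nil, List.length_nil, pow_zero, Matrix.one_apply]
    refine if_congr ?_ rfl rfl
    rw [eq_comm (a := []), List.drop_eq_nil_iff, ← hz]
    constructor
    · rintro rfl; exact le_rfl
    · intro h
      simp only [List.length_nil] at hu
      exact hν (by omega)
  | cons j l ih =>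
    simp only [List.length_cons] at hu
    rw [List.map_cons, List.prod_cons, Matrix.mul_apply]
    obtain ⟨y, hy⟩ := hsurj (ν u + 1) (by omega)
    rw [Finset.sum_eq_single y]
    · rw [ih y (by omega), hy]
      have hlt : ν u < w.length := by omega
      have hdown : ¬ (ν u = ν u + 1 + 1 ∧ w[ν u + 1]? = some j) := by omega
      rw [Matrix.smul_apply, pathMat_apply, hy]
      simp only [List.drop_eq_getElem_cons hlt, List.cons.injEq, List.getElem?_eq_getElem hlt,
        Option.some.injEq, true_and, smul_eq_mul, hdown, or_false, List.length_cons,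
        eq_comm (a := w[ν u])]
      by_cases h1 : j = w[ν u] <;> by_cases h2 : l = w.drop (ν u + 1) <;>
        simp only [h1, h2, pow_succ', and_true, and_false, and_self, if_true, if_false, mul_one,
          mul_zero, zero_mul]
    · intro x _ hx
      rw [Matrix.smul_apply, pathMat_apply]
      split_ifs with h
      · rcases h with h | h
        · exact absurd (hν (h.1.trans hy.symm)) hx
        · rw [ih x (by omega), if_neg, mul_zero]
          intro hl
          have := congrArg List.length hl
          rw [List.length_drop] at this
          omega
      · simp
    · simp

/-- A nonzero free polynomial does not vanish on suitable symmetric matrices of any given large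
size, even after changing their signs. -/
lemma exists_symm_lift_ne_zero {g : ℕ} {h : FreeAlgebra ℝ (Fin g)} (hh : h ≠ 0) :
    ∃ d : ℕ, ∀ (V : Type) [Fintype V] [DecidableEq V], d < Fintype.card V →
      ∃ Y : Fin g → Matrix V V ℝ, (∀ j, (Y j).IsSymm) ∧
        ∀ ε : ℝ, ε ≠ 0 → FreeAlgebra.lift ℝ (fun j => ε • Y j) h ≠ 0 := by
  set f := (FreeAlgebra.equivMonoidAlgebraFreeMonoid h).coeff with hf
  have hf0 : f ≠ 0 := by
    intro h0
    apply hh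
    apply FreeAlgebra.equivMonoidAlgebraFreeMonoid.injective
    rw [map_zero]
    exact MonoidAlgebra.coeff_injective h0
  obtain ⟨w, hw, hmax⟩ := f.support.exists_max_image (fun w => w.toList.length)
    (Finsupp.support_nonempty_iff.mpr hf0)
  refine ⟨w.toList.length, fun V _ _ hV => ?_⟩
  let e := Fintype.equivFin V
  let ν : V → ℕ := fun v => e v
  have hν : Function.Injective ν := fun a b hab => e.injective (Fin.ext hab)
  have hsurj : ∀ i ≤ w.toList.length, ∃ v, ν v = i := fun i hi =>
    ⟨e.symm ⟨i, by omega⟩, by simp [ν]⟩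
  obtain ⟨z, hz⟩ := hsurj _ le_rfl
  obtain ⟨s, hs⟩ := hsurj 0 (Nat.zero_le _)
  refine ⟨pathMat ν w.toList, pathMat_isSymm ν _, fun ε hε h0 => ?_⟩
  have h1 := congrFun (congrFun h0 s) z
  rw [freeAlgebra_lift_eq_sum, ← hf, Finsupp.sum, Matrix.sum_apply, Finset.sum_eq_single w] at h1
  · rw [Matrix.smul_apply, prod_pathMat_apply hν _ hsurj hz _ _ _ (by omega), hs, List.drop_zero,
      if_pos rfl, smul_eq_mul, Matrix.zero_apply, mul_eq_zero] at h1
    exact h1.elim (Finsupp.mem_support_iff.mp hw) (pow_ne_zero _ hε)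
  · intro u hu huw
    have := hmax u hu
    rw [Matrix.smul_apply, prod_pathMat_apply hν _ hsurj hz _ _ _ (by omega), hs, List.drop_zero,
      if_neg (fun h => huw (FreeMonoid.toList.injective h)), smul_zero]
  · exact fun h => absurd hw h

/-! ### Graded deformations -/

/-- The Pauli matrix attached to a pair of exponent vectors. -/
def pauliMonomial {k : ℕ} (a : Fin k ⊕ Fin k → ℕ) :
    Matrix (Fin k → ZMod 2) (Fin k → ZMod 2) ℝ :=
  pauli (fun i => (a (.inl i) : ZMod 2)) (fun i => (a (.inr i) : ZMod 2))

lemma pauliMonomial_zero {k : ℕ} : pauliMonomial (0 : Fin k ⊕ Fin k → ℕ) = 1 := by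
  rw [← pauli_zero]
  simp only [pauliMonomial, Pi.zero_apply, Nat.cast_zero]
  rfl

lemma pauliMonomial_mul {k : ℕ} (a b : Fin k ⊕ Fin k → ℕ) :
    ∃ c : ℝ, pauliMonomial a * pauliMonomial b = c • pauliMonomial (a + b) := by
  refine ⟨_, (pauli_mul _ _ _ _).trans (congrArg _ ?_)⟩
  simp only [pauliMonomial, Pi.add_apply, Nat.cast_add]
  rfl

/-- Matrix-valued functions which are combinations of the monomials `r ^ w a • pauliMonomial a`
with all exponents at most `D`. -/
def gradedSpan {k : ℕ} (w : (Fin k ⊕ Fin k → ℕ) →+ ℕ) (D : ℕ) :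
    Submodule ℝ (ℝ → Matrix (Fin k → ZMod 2) (Fin k → ZMod 2) ℝ) :=
  Submodule.span ℝ ((fun a r => r ^ w a • pauliMonomial a) '' (Set.Iic fun _ => D))

lemma gradedSpan_mono {k : ℕ} (w : (Fin k ⊕ Fin k → ℕ) →+ ℕ) {D E : ℕ} (h : D ≤ E) :
    gradedSpan w D ≤ gradedSpan w E :=
  Submodule.span_mono (Set.image_mono fun _ ha i => (ha i).trans h)

lemma one_mem_gradedSpan {k : ℕ} (w : (Fin k ⊕ Fin k → ℕ) →+ ℕ) (D : ℕ) :
    1 ∈ gradedSpan w D := by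
  refine Submodule.subset_span ⟨0, fun _ => Nat.zero_le _, ?_⟩
  funext r
  simp [pauliMonomial_zero]

lemma mul_mem_gradedSpan {k : ℕ} (w : (Fin k ⊕ Fin k → ℕ) →+ ℕ) {D E : ℕ}
    {F G : ℝ → Matrix (Fin k → ZMod 2) (Fin k → ZMod 2) ℝ}
    (hF : F ∈ gradedSpan w D) (hG : G ∈ gradedSpan w E) : F * G ∈ gradedSpan w (D + E) := by
  have h := Submodule.mul_mem_mul hF hG
  rw [gradedSpan, gradedSpan, Submodule.span_mul_span] at h
  refine Submodule.span_le.mpr ?_ h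
  rintro _ ⟨_, ⟨a, ha, rfl⟩, _, ⟨b, hb, rfl⟩, rfl⟩
  obtain ⟨c, hc⟩ := pauliMonomial_mul a b
  have : ((fun r : ℝ => r ^ w a • pauliMonomial a) * fun r : ℝ => r ^ w b • pauliMonomial b) =
      c • fun r : ℝ => r ^ w (a + b) • pauliMonomial (a + b) := by
    funext r
    simp only [Pi.mul_apply, Pi.smul_apply]
    rw [smul_mul_smul_comm, hc, map_add, pow_add, smul_comm]
  change (fun r : ℝ => r ^ w a • pauliMonomial a) * (fun r : ℝ => r ^ w b • pauliMonomial b) ∈ _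
  rw [this]
  exact Submodule.smul_mem _ _ (Submodule.subset_span ⟨a + b, fun i => add_le_add (ha i) (hb i), rfl⟩)

lemma list_prod_mem_gradedSpan {k g : ℕ} (w : (Fin k ⊕ Fin k → ℕ) →+ ℕ) {D : ℕ}
    {X : Fin g → ℝ → Matrix (Fin k → ZMod 2) (Fin k → ZMod 2) ℝ}
    (hX : ∀ j, X j ∈ gradedSpan w D) (l : List (Fin g)) :
    (l.map X).prod ∈ gradedSpan w (D * l.length) := by
  induction l with
  | nil => exact one_mem_gradedSpan w _
  | cons j l ih =>
    rw [List.map_cons, List.prod_cons, List.length_cons, mul_add, mul_one, add_comm]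
    exact mul_mem_gradedSpan w (hX j) ih

lemma exists_lift_mem_gradedSpan {g : ℕ} (h : FreeAlgebra ℝ (Fin g)) :
    ∃ d : ℕ, ∀ (k : ℕ) (w : (Fin k ⊕ Fin k → ℕ) →+ ℕ) (D : ℕ)
      (X : Fin g → ℝ → Matrix (Fin k → ZMod 2) (Fin k → ZMod 2) ℝ),
      (∀ j, X j ∈ gradedSpan w D) → FreeAlgebra.lift ℝ X h ∈ gradedSpan w (D * d) := by
  refine ⟨(FreeAlgebra.equivMonoidAlgebraFreeMonoid h).coeff.support.sup
    fun u => u.toList.length, fun k w D X hX => ?_⟩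
  rw [freeAlgebra_lift_eq_sum]
  exact Submodule.sum_mem _ fun u hu => Submodule.smul_mem _ _ <|
    gradedSpan_mono w (Nat.mul_le_mul_left _
      (Finset.le_sup (f := fun u : FreeMonoid (Fin g) => u.toList.length) hu))
      (list_prod_mem_gradedSpan w hX u.toList)

lemma exists_injOn_weight (k D : ℕ) :
    ∃ w : (Fin k ⊕ Fin k → ℕ) →+ ℕ, Set.InjOn w (Set.Iic fun _ => D) ∧
      ∀ a, a ≠ 0 → w a ≠ 0 := by
  let e := Fintype.equivFin (Fin k ⊕ Fin k)
  refine ⟨{ toFun := fun a => ∑ i, a (e.symm i) * (D + 1) ^ (i : ℕ)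
            map_zero' := by simp
            map_add' := fun a b => by simp [add_mul, Finset.sum_add_distrib] }, ?_, ?_⟩
  · intro a ha b hb hab
    let f : (Fin k ⊕ Fin k → ℕ) → Fin (Fintype.card (Fin k ⊕ Fin k)) → Fin (D + 1) :=
      fun c i => Fin.ofNat (D + 1) (c (e.symm i))
    have hf : ∀ c : Fin k ⊕ Fin k → ℕ, c ≤ (fun _ => D) → ∀ i, (f c i : ℕ) = c (e.symm i) :=
      fun c hc i => Nat.mod_eq_of_lt (Nat.lt_succ_of_le (hc _))
    have hfab : f a = f b := by
      apply finFunctionFinEquiv.injective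
      apply Fin.ext
      rw [finFunctionFinEquiv_apply, finFunctionFinEquiv_apply]
      simp only [hf a ha, hf b hb]
      exact hab
    funext x
    have := congrArg Fin.val (congrFun hfab (e x))
    rwa [hf a ha, hf b hb, e.symm_apply_apply] at this
  · intro a ha h0
    obtain ⟨x, hx⟩ := Function.ne_iff.mp ha
    have h1 := (Finset.sum_eq_zero_iff.mp h0) (e x) (Finset.mem_univ _)
    rw [e.symm_apply_apply] at h1
    exact hx ((mul_eq_zero.mp h1).resolve_right (by positivity))

lemma exists_symm_deformation {k : ℕ} {w : (Fin k ⊕ Fin k → ℕ) →+ ℕ} (hk : 0 < k)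
    (hw : ∀ a, a ≠ 0 → w a ≠ 0) {Y : Matrix (Fin k → ZMod 2) (Fin k → ZMod 2) ℝ}
    (hY : Y.IsSymm) :
    ∃ X ∈ gradedSpan w 2, (∀ r, (X r).IsSymm) ∧ X 1 = Y ∧ X 0 = 0 := by
  have hspan := mem_span_symm_pauli hY
  clear hY
  induction hspan using Submodule.span_induction with
  | mem M hM =>
    obtain ⟨hM, a, b, rfl⟩ := hM
    let n : ZMod 2 → ℕ := fun z => if z = 0 then 2 else 1
    have hn : ∀ z, ((n z : ℕ) : ZMod 2) = z := by decide
    have hn2 : ∀ z, n z ≤ 2 := by decide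
    have hn0 : ∀ z, n z ≠ 0 := by decide
    let c : Fin k ⊕ Fin k → ℕ := Sum.elim (fun i => n (a i)) (fun i => n (b i))
    have hc : pauliMonomial c = pauli a b := by
      simp only [pauliMonomial, c, Sum.elim_inl, Sum.elim_inr, hn]
    have hc0 : c ≠ 0 := fun h => hn0 _ (congrFun h (.inl ⟨0, hk⟩))
    refine ⟨fun r => r ^ w c • pauliMonomial c, Submodule.subset_span ⟨c, ?_, rfl⟩, fun r => ?_,
      ?_, ?_⟩
    · rintro (i | i) <;> exact hn2 _
    · rw [hc]; exact hM.smul _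
    · simp [hc]
    · simp [hw c hc0]
  | zero => exact ⟨0, zero_mem _, fun r => Matrix.isSymm_zero, rfl, rfl⟩
  | add A B _ _ hA hB =>
    obtain ⟨X, hX, hXs, hX1, hX0⟩ := hA
    obtain ⟨Z, hZ, hZs, hZ1, hZ0⟩ := hB
    exact ⟨X + Z, add_mem hX hZ, fun r => (hXs r).add (hZs r), by simp [hX1, hZ1],
      by simp [hX0, hZ0]⟩
  | smul c A _ hA =>
    obtain ⟨X, hX, hXs, hX1, hX0⟩ := hA
    exact ⟨c • X, Submodule.smul_mem _ c hX, fun r => (hXs r).smul c, by simp [hX1],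
      by simp [hX0]⟩

lemma exists_leading_term {k D : ℕ} {w : (Fin k ⊕ Fin k → ℕ) →+ ℕ}
    (hw : Set.InjOn w (Set.Iic fun _ => D))
    {F : ℝ → Matrix (Fin k → ZMod 2) (Fin k → ZMod 2) ℝ} (hF : F ∈ gradedSpan w D)
    (h1 : F 1 ≠ 0) (h0 : F 0 = 0) :
    ∃ (s : ℕ) (L : Matrix (Fin k → ZMod 2) (Fin k → ZMod 2) ℝ) (c : ℝ), 0 < s ∧ 0 < c ∧
      L.transpose * L = c • 1 ∧
      Filter.Tendsto (fun r => (r ^ s)⁻¹ • F r) Filter.atTop (nhds L) := by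
  rw [gradedSpan, ← Finset.coe_Iic, Submodule.mem_span_image_finset_iff_exists_fun'] at hF
  obtain ⟨c, hc⟩ := hF
  have hFr : ∀ r, F r = ∑ a ∈ Finset.Iic (fun _ => D), c a • r ^ w a • pauliMonomial a := by
    intro r
    rw [← hc]
    simp [Finset.sum_apply]
  have hne : ((Finset.Iic fun _ => D).filter fun a => c a ≠ 0).Nonempty := by
    by_contra hempty
    rw [Finset.not_nonempty_iff_eq_empty, Finset.filter_eq_empty_iff] at hempty
    refine h1 ((hFr 1).trans (Finset.sum_eq_zero fun a ha => ?_))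
    rw [not_not.mp (hempty ha), zero_smul]
  obtain ⟨m, hm, hmax⟩ := Finset.exists_max_image _ w hne
  rw [Finset.mem_filter] at hm
  have hlt : ∀ a ∈ Finset.Iic (fun _ => D), a ≠ m → c a ≠ 0 → w a < w m := by
    intro a ha ham hca
    refine lt_of_le_of_ne (hmax a (Finset.mem_filter.mpr ⟨ha, hca⟩)) fun h => ham (hw ?_ ?_ h)
    · exact Finset.mem_Iic.mp ha
    · exact Finset.mem_Iic.mp hm.1
  have hLL : (pauliMonomial m).transpose * pauliMonomial m = 1 := pauli_transpose_mul_self _ _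
  refine ⟨w m, c m • pauliMonomial m, c m * c m, Nat.pos_of_ne_zero fun hwm => ?_,
    mul_self_pos.mpr hm.2, ?_, ?_⟩
  · rw [hFr, Finset.sum_eq_single m, hwm, pow_zero, one_smul, smul_eq_zero] at h0
    · rcases h0 with h0 | h0
      · exact hm.2 h0
      · rw [h0, mul_zero] at hLL
        exact zero_ne_one hLL
    · intro a ha ham
      by_cases hca : c a = 0
      · rw [hca, zero_smul]
      · exact absurd (hlt a ha ham hca) (by omega)
    · exact fun h => absurd hm.1 h
  · rw [Matrix.transpose_smul, smul_mul_smul_comm, hLL]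
  · simp_rw [hFr, Finset.smul_sum]
    have hsum : c m • pauliMonomial m =
        ∑ a ∈ Finset.Iic (fun _ => D), if a = m then c a • pauliMonomial a else 0 := by
      rw [Finset.sum_ite_eq', if_pos hm.1]
    rw [hsum]
    refine tendsto_finsetSum _ fun a ha => ?_
    have hcomm : ∀ r : ℝ, (r ^ w m)⁻¹ • c a • r ^ w a • pauliMonomial a =
        ((r ^ w m)⁻¹ * r ^ w a) • c a • pauliMonomial a := fun r => by
      rw [smul_comm (c a), smul_smul]
    simp_rw [hcomm]
    split_ifs with ham
    · subst ham
      refine tendsto_const_nhds.congr' ?_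
      filter_upwards [Filter.eventually_gt_atTop 0] with r hr
      rw [inv_mul_cancel₀ (pow_pos hr _).ne', one_smul]
    · by_cases hca : c a = 0
      · simp [hca]
      · have h2 : Filter.Tendsto (fun r : ℝ => (r ^ w m)⁻¹ * r ^ w a) Filter.atTop (nhds 0) := by
          have h3 := tendsto_pow_neg_atTop (𝕜 := ℝ) (n := w m - w a)
            (Nat.sub_pos_of_lt (hlt a ha ham hca)).ne'
          refine h3.congr' ?_
          filter_upwards [Filter.eventually_gt_atTop 0] with r hr
          have hadd : w m = (w m - w a) + w a := by have := hlt a ha ham hca; omega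
          rw [zpow_neg, zpow_natCast]
          nth_rewrite 2 [hadd]
          rw [pow_add]
          field_simp
        simpa using h2.smul_const (c a • pauliMonomial a)

/-! ### Positivity -/

lemma eventually_posDef_of_tendsto {V : Type} [Fintype V] [DecidableEq V] {c : ℝ} (hc : 0 < c)
    {P : ℝ → Matrix V V ℝ} (hP : ∀ r, (P r).IsSymm)
    (hlim : Filter.Tendsto P Filter.atTop (nhds (c • 1))) :
    ∀ᶠ r in Filter.atTop, (P r).PosDef := by
  set δ : ℝ := c / (Fintype.card V + 1) with hδ
  have hδ0 : 0 < δ := by positivity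
  have hent : ∀ᶠ r in Filter.atTop, ∀ i j, |P r i j - (c • (1 : Matrix V V ℝ)) i j| < δ := by
    rw [Filter.eventually_all]; intro i
    rw [Filter.eventually_all]; intro j
    have h1 : Filter.Tendsto (fun r => P r i j) Filter.atTop
        (nhds ((c • (1 : Matrix V V ℝ)) i j)) :=
      ((continuous_id.matrix_elem i j).tendsto _).comp hlim
    have := Metric.tendsto_nhds.mp h1 δ hδ0
    simpa only [Real.dist_eq] using this
  filter_upwards [hent] with r hr
  refine Matrix.PosDef.of_dotProduct_mulVec_pos
    ((Matrix.conjTranspose_eq_transpose_of_trivial (P r)).trans (hP r)) fun x hx => ?_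
  set E := P r - c • (1 : Matrix V V ℝ) with hE
  have hPE : P r = c • 1 + E := by rw [hE]; abel
  have hxx : 0 < x ⬝ᵥ x := by
    have := Matrix.dotProduct_star_self_pos_iff.mpr hx
    simpa using this
  have hEb : |x ⬝ᵥ E.mulVec x| ≤ δ * Fintype.card V * (x ⬝ᵥ x) := by
    have h1 : x ⬝ᵥ E.mulVec x = ∑ i, ∑ j, x i * E i j * x j := by
      simp only [dotProduct, Matrix.mulVec, Finset.mul_sum, mul_assoc]
    have h2 : ∀ i j, |x i * E i j * x j| ≤ δ * ((x i * x i + x j * x j) / 2) := by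
      intro i j
      rw [abs_mul, abs_mul]
      have h3 : |E i j| ≤ δ := (hr i j).le
      have h4 : |x i| * |x j| ≤ (x i * x i + x j * x j) / 2 := by
        nlinarith [sq_nonneg (|x i| - |x j|), abs_mul_abs_self (x i), abs_mul_abs_self (x j)]
      calc |x i| * |E i j| * |x j| = |E i j| * (|x i| * |x j|) := by ring
        _ ≤ δ * ((x i * x i + x j * x j) / 2) := by gcongr
    rw [h1]
    calc |∑ i, ∑ j, x i * E i j * x j| ≤ ∑ i, ∑ j, |x i * E i j * x j| :=
          (Finset.abs_sum_le_sum_abs _ _).trans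
            (Finset.sum_le_sum fun i _ => Finset.abs_sum_le_sum_abs _ _)
      _ ≤ ∑ i, ∑ j, δ * ((x i * x i + x j * x j) / 2) :=
          Finset.sum_le_sum fun i _ => Finset.sum_le_sum fun j _ => h2 i j
      _ = δ * Fintype.card V * (x ⬝ᵥ x) := by
          have h5 : ∀ f : V → ℝ, ∑ i, ∑ j, δ * ((f i + f j) / 2) =
              δ * Fintype.card V * ∑ i, f i := fun f => by
            simp only [← Finset.mul_sum, ← Finset.sum_div, Finset.sum_add_distrib,
              Finset.sum_const, Finset.card_univ, nsmul_eq_mul]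
            ring
          exact h5 fun i => x i * x i
  have hlt : δ * Fintype.card V < c := by
    rw [hδ, div_mul_eq_mul_div, div_lt_iff₀ (by positivity)]
    nlinarith
  rw [star_trivial, hPE, Matrix.add_mulVec, dotProduct_add, Matrix.smul_mulVec, Matrix.one_mulVec,
    dotProduct_smul, smul_eq_mul]
  nlinarith [neg_abs_le (x ⬝ᵥ E.mulVec x)]

lemma eventually_posDef_add_transpose_mul_self {V : Type} [Fintype V] [DecidableEq V]
    {B : Matrix V V ℝ} (hB : B.IsSymm) {F : ℝ → Matrix V V ℝ} {s : ℕ} (hs : 0 < s)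
    {L : Matrix V V ℝ} {c : ℝ} (hc : 0 < c) (hL : L.transpose * L = c • 1)
    (hF : Filter.Tendsto (fun r => (r ^ s)⁻¹ • F r) Filter.atTop (nhds L)) :
    ∀ᶠ r in Filter.atTop, (B + (F r).transpose * F r).PosDef := by
  have hinv : Filter.Tendsto (fun r : ℝ => (r ^ s)⁻¹) Filter.atTop (nhds 0) :=
    tendsto_inv_atTop_zero.comp (Filter.tendsto_pow_atTop hs.ne')
  have hlim : Filter.Tendsto (fun r : ℝ => ((r ^ s)⁻¹ * (r ^ s)⁻¹) • (B + (F r).transpose * F r))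
      Filter.atTop (nhds (c • 1)) := by
    have h1 := ((hinv.mul hinv).smul_const B).add
      ((((continuous_id.matrix_transpose).tendsto L).comp hF).mul hF)
    rw [mul_zero, zero_smul, zero_add, id, hL] at h1
    refine h1.congr fun r => ?_
    simp only [Function.comp_apply, id, Matrix.transpose_smul, smul_mul_smul_comm, smul_add]
  have hsymm : ∀ r, (B + (F r).transpose * F r).IsSymm := fun r =>
    hB.add (Matrix.isSymm_transpose_mul_self _)
  filter_upwards [eventually_posDef_of_tendsto hc (fun r => (hsymm r).smul _) hlim,
    Filter.eventually_gt_atTop 0] with r hr hr0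
  have := hr.smul (show 0 < r ^ s * r ^ s by positivity)
  rwa [smul_smul, show r ^ s * r ^ s * ((r ^ s)⁻¹ * (r ^ s)⁻¹) = 1 by field_simp, one_smul] at this

/-! ### Sums of squares -/

lemma lift_star_eq_transpose {g : ℕ} {V : Type} [Fintype V] [DecidableEq V]
    {X : Fin g → Matrix V V ℝ} (hX : ∀ j, (X j).IsSymm) (h : FreeAlgebra ℝ (Fin g)) :
    FreeAlgebra.lift ℝ X (star h) = (FreeAlgebra.lift ℝ X h).transpose := by
  induction h using FreeAlgebra.induction with
  | grade0 r =>
    rw [FreeAlgebra.star_algebraMap, AlgHom.commutes, Algebra.algebraMap_eq_smul_one,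
      Matrix.transpose_smul, Matrix.transpose_one]
  | grade1 j => rw [FreeAlgebra.star_ι, FreeAlgebra.lift_ι_apply, hX j]
  | mul a b ha hb => rw [star_mul, map_mul, map_mul, ha, hb, Matrix.transpose_mul]
  | add a b ha hb => rw [star_add, map_add, map_add, ha, hb, Matrix.transpose_add]

lemma lift_apply_apply {g : ℕ} {V : Type} [Fintype V] [DecidableEq V]
    (X : Fin g → ℝ → Matrix V V ℝ) (h : FreeAlgebra ℝ (Fin g)) (r : ℝ) :
    FreeAlgebra.lift ℝ X h r = FreeAlgebra.lift ℝ (fun j => X j r) h := by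
  have : (Pi.evalAlgHom ℝ (fun _ : ℝ => Matrix V V ℝ) r).comp (FreeAlgebra.lift ℝ X) =
      FreeAlgebra.lift ℝ (fun j => X j r) := by
    refine FreeAlgebra.hom_ext (funext fun j => ?_)
    simp
  exact DFunLike.congr_fun this h

lemma lift_zero_eq_algebraMap {g : ℕ} {V : Type} [Fintype V] [DecidableEq V]
    (f : FreeAlgebra ℝ (Fin g)) :
    FreeAlgebra.lift ℝ (fun _ => (0 : Matrix V V ℝ)) f =
      algebraMap ℝ _ (FreeAlgebra.algebraMapInv f) := by
  have hcomp : FreeAlgebra.lift ℝ (fun _ : Fin g => (0 : Matrix V V ℝ)) =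
      (Algebra.ofId ℝ (Matrix V V ℝ)).comp FreeAlgebra.algebraMapInv := by
    refine FreeAlgebra.hom_ext (funext fun j => ?_)
    simp [FreeAlgebra.algebraMapInv]
  rw [hcomp, AlgHom.comp_apply, Algebra.ofId_apply]

lemma exists_posDef_add_lift {g : ℕ} {h : FreeAlgebra ℝ (Fin g)} (hh : h ≠ 0)
    (h0 : ∀ (V : Type) [Fintype V] [DecidableEq V],
      FreeAlgebra.lift ℝ (fun _ => (0 : Matrix V V ℝ)) h = 0) (N : ℕ) :
    ∃ k, N ≤ 2 ^ k ∧ ∀ B : Matrix (Fin k → ZMod 2) (Fin k → ZMod 2) ℝ, B.IsSymm →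
      ∃ X : Fin g → Matrix (Fin k → ZMod 2) (Fin k → ZMod 2) ℝ, (∀ j, (X j).IsSymm) ∧
        (B + (FreeAlgebra.lift ℝ X h).transpose * FreeAlgebra.lift ℝ X h).PosDef ∧
        (B + (FreeAlgebra.lift ℝ (-X) h).transpose * FreeAlgebra.lift ℝ (-X) h).PosDef := by
  obtain ⟨d, hd⟩ := exists_symm_lift_ne_zero hh
  obtain ⟨e, he⟩ := exists_lift_mem_gradedSpan h
  obtain ⟨k, hk0, hkN, hkd⟩ : ∃ k, 0 < k ∧ N ≤ 2 ^ k ∧ d < 2 ^ k :=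
    ⟨N + d + 1, by omega, by have := Nat.lt_two_pow_self (n := N + d + 1); omega,
      by have := Nat.lt_two_pow_self (n := N + d + 1); omega⟩
  refine ⟨k, hkN, fun B hB => ?_⟩
  obtain ⟨Y, hYs, hY⟩ := hd (Fin k → ZMod 2) (by simpa using hkd)
  obtain ⟨w, hw, hw0⟩ := exists_injOn_weight k (2 * e)
  choose X hX hXs hX1 hX0 using fun j => exists_symm_deformation hk0 hw0 (hYs j)
  have key : ∀ ε : ℝ, ε ≠ 0 → ∀ᶠ r in Filter.atTop,
      (B + (FreeAlgebra.lift ℝ (fun j => ε • X j r) h).transpose *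
        FreeAlgebra.lift ℝ (fun j => ε • X j r) h).PosDef := by
    intro ε hε
    have hF := he k w 2 (fun j => ε • X j) fun j => Submodule.smul_mem _ ε (hX j)
    obtain ⟨s, L, c, hs, hc, hL, hlim⟩ := exists_leading_term hw hF
      (by rw [lift_apply_apply]; simpa [hX1] using hY ε hε)
      (by rw [lift_apply_apply]; simpa [hX0] using h0 _)
    have := eventually_posDef_add_transpose_mul_self hB hs hc hL hlim
    simp only [lift_apply_apply] at this
    exact this
  obtain ⟨r, hr1, hr2⟩ := ((key 1 one_ne_zero).and (key (-1) (by norm_num))).exists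
  refine ⟨fun j => X j r, fun j => hXs j r, by simpa using hr1, ?_⟩
  simp only [neg_smul, one_smul] at hr2
  exact hr2

lemma posDef_add_sum_lift {g m : ℕ} {V : Type} [Fintype V] [DecidableEq V] (B : Matrix V V ℝ)
    (h : Fin m → FreeAlgebra ℝ (Fin g)) {X : Fin g → Matrix V V ℝ} (hX : ∀ j, (X j).IsSymm)
    (i : Fin m)
    (hi : (B + (FreeAlgebra.lift ℝ X (h i)).transpose * FreeAlgebra.lift ℝ X (h i)).PosDef) :
    (B + FreeAlgebra.lift ℝ X (∑ j, star (h j) * h j)).PosDef := by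
  rw [map_sum, ← Finset.add_sum_erase _ _ (Finset.mem_univ i), ← add_assoc, map_mul,
    lift_star_eq_transpose hX]
  refine hi.add_posSemidef (Matrix.posSemidef_sum _ fun j _ => ?_)
  rw [map_mul, lift_star_eq_transpose hX, ← Matrix.conjTranspose_eq_transpose_of_trivial]
  exact Matrix.posSemidef_conjTranspose_mul_self _

lemma lift_zero_eq_zero_of_sum {g m : ℕ} (h : Fin m → FreeAlgebra ℝ (Fin g))
    (hsum : FreeAlgebra.algebraMapInv (∑ j, star (h j) * h j) = (0 : ℝ)) (i : Fin m)
    (V : Type) [Fintype V] [DecidableEq V] :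
    FreeAlgebra.lift ℝ (fun _ => (0 : Matrix V V ℝ)) (h i) = 0 := by
  have hstar : ∀ f : FreeAlgebra ℝ (Fin g),
      FreeAlgebra.algebraMapInv (star f) = FreeAlgebra.algebraMapInv f := by
    intro f
    induction f using FreeAlgebra.induction with
    | grade0 r => rw [FreeAlgebra.star_algebraMap]
    | grade1 j => rw [FreeAlgebra.star_ι]
    | mul a b ha hb => rw [star_mul, map_mul, map_mul, ha, hb, mul_comm]
    | add a b ha hb => rw [star_add, map_add, map_add, ha, hb]
  rw [map_sum, Finset.sum_eq_zero_iff_of_nonneg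
    (fun j _ => by rw [map_mul, hstar]; exact mul_self_nonneg _)] at hsum
  have hi := hsum i (Finset.mem_univ i)
  rw [map_mul, hstar, mul_self_eq_zero] at hi
  rw [lift_zero_eq_algebraMap, hi, map_zero]

lemma lift_submatrix {g : ℕ} {V W : Type} [Fintype V] [DecidableEq V] [Fintype W] [DecidableEq W]
    (e : W ≃ V) (X : Fin g → Matrix V V ℝ) (h : FreeAlgebra ℝ (Fin g)) :
    FreeAlgebra.lift ℝ (fun j => (X j).submatrix e e) h =
      (FreeAlgebra.lift ℝ X h).submatrix e e := by
  have : FreeAlgebra.lift ℝ (fun j => (X j).submatrix e e) =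
      ((Matrix.reindexAlgEquiv ℝ ℝ e.symm).toAlgHom).comp (FreeAlgebra.lift ℝ X) := by
    refine FreeAlgebra.hom_ext (funext fun j => ?_)
    simp
  rw [this]
  simp

/-- If `p` is symmetric and quasi-convex and there is an `N` such that for every
`n ≥ N` there is a symmetric `B ∈ 𝕊ₙ(ℝ)` which is not positive semidefinite and for which
`{X ∈ 𝕊ₙ(ℝ^g) : B − p(X) ≻ 0}` is convex, then `-p` is a hermitian sum of squares iff `p = 0`. -/
theorem stmt_1 (g : ℕ) (p : FreeAlgebra ℝ (Fin g))
    (hsym : star p = p) (hqc : IsQuasiConvex p)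
    (hB : ∃ N : ℕ, 0 < N ∧ ∀ n : ℕ, N ≤ n →
      ∃ B : Matrix (Fin n) (Fin n) ℝ, B.IsSymm ∧ ¬ B.PosSemidef ∧
        Convex ℝ {X : Fin g → Matrix (Fin n) (Fin n) ℝ |
          (∀ j, (X j).IsSymm) ∧ (B - evalMat p X).PosDef}) :
    IsHermitianSOS (-p) ↔ p = 0 := by
  refine ⟨fun ⟨m, h, hp⟩ => ?_, fun hp => ⟨0, Fin.elim0, by simp [hp]⟩⟩
  by_contra hp0
  obtain ⟨i, hi⟩ : ∃ i, h i ≠ 0 := by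
    by_contra! hall
    exact hp0 (neg_eq_zero.mp (by rw [hp]; simp [hall]))
  have hconst : FreeAlgebra.algebraMapInv (∑ j, star (h j) * h j) = (0 : ℝ) := by
    have h1 := hqc.1 1
    rw [evalMat, lift_zero_eq_algebraMap] at h1
    rw [← hp, map_neg, (FaithfulSMul.algebraMap_injective ℝ (Matrix (Fin 1) (Fin 1) ℝ))
      (h1.trans (map_zero _).symm), neg_zero]
  obtain ⟨N, -, hB⟩ := hB
  obtain ⟨k, hkN, hk⟩ := exists_posDef_add_lift hi
    (fun V _ _ => lift_zero_eq_zero_of_sum h hconst i V) N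
  obtain ⟨B, hBs, hBn, hconv⟩ := hB (2 ^ k) hkN
  let e : Fin (2 ^ k) ≃ (Fin k → ZMod 2) := (Fintype.equivFinOfCardEq (by simp)).symm
  obtain ⟨X, hXs, hX1, hX2⟩ := hk (B.submatrix e.symm e.symm) (hBs.submatrix e.symm)
  have hmem : ∀ Z : Fin g → Matrix (Fin k → ZMod 2) (Fin k → ZMod 2) ℝ, (∀ j, (Z j).IsSymm) →
      (B.submatrix e.symm e.symm + (FreeAlgebra.lift ℝ Z (h i)).transpose *
        FreeAlgebra.lift ℝ Z (h i)).PosDef →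
      (fun j => (Z j).submatrix e e) ∈ {X : Fin g → Matrix (Fin (2 ^ k)) (Fin (2 ^ k)) ℝ |
        (∀ j, (X j).IsSymm) ∧ (B - evalMat p X).PosDef} := by
    intro Z hZ hpos
    refine ⟨fun j => (hZ j).submatrix e, ?_⟩
    have h1 := (posDef_add_sum_lift _ h hZ i hpos).submatrix e.injective
    rw [← hp, map_neg, ← sub_eq_add_neg] at h1
    rw [evalMat, lift_submatrix]
    simpa [Matrix.submatrix_sub] using h1
  have hmid := hconv (hmem X hXs hX1) (hmem (-X) (fun j => (hXs j).neg) hX2)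
    (show (0 : ℝ) ≤ 1 / 2 by norm_num) (show (0 : ℝ) ≤ 1 / 2 by norm_num) (by norm_num)
  have hzero : ((1 / 2 : ℝ) • (fun j => (X j).submatrix e e) +
      (1 / 2 : ℝ) • fun j => ((-X) j).submatrix e e) =
      fun _ : Fin g => (0 : Matrix (Fin (2 ^ k)) (Fin (2 ^ k)) ℝ) := by
    funext j
    ext u v
    simp
  rw [hzero] at hmid
  have hpd := hmid.2
  rw [hqc.1, sub_zero] at hpd
  exact hBn hpd.posSemidef
end
end
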